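/- arXiv:2409.17006 — 5 statements merged into one kernel-verified Lean document; each statement's English description precedes it below -/
import Mathlib

section
/- Let d ≥ 1, k = d+1, let ω ∈ 𝒢_{k,ℓ} with ℓ ≥ 2, and let Λ = Aℤ^k be a unimodular lattice in ℝ^k with dual Λ* = (A^{−1})ᵀℤ^k. Suppose φ : [1,∞) → [1,∞) is non-decreasing, that H(λ)·|λ_k| < 1/φ(H(λ)) holds for infinitely many (λ,λ_k) ∈ Λ*, and that L : [φ(1),∞) → [1,∞) satisfies L(x)·φ(L(x)) = x for all x ≥ φ(1). Then there is a constant c > 0 such that for every M there exist an integer N ≥ max{M, φ(1)} and a test box 𝔅 = (γ;ρ) with |D_ω^Λ(𝔅;N)| ≥ c·φ(L(N)). -/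
open scoped BigOperators

/-- The Fourier transform `∫ w(x) e^{-2πiξx} dx` of a real weight function. -/
noncomputable def fhat (w : ℝ → ℝ) (ξ : ℝ) : ℂ :=
  ∫ x : ℝ, (w x : ℂ) * Complex.exp (-(2 * Real.pi * Complex.I * ξ * x))

/-- The class 𝒢_{k,ℓ} of good weight tuples. -/
def GoodWeights (k ℓ : ℕ) (w : Fin k → ℝ → ℝ) : Prop :=
  ∀ i : Fin k,
    (∀ x, 0 ≤ w i x) ∧
    (Function.support (w i) ⊆ Set.Icc (-2 : ℝ) 2) ∧
    ContDiff ℝ ℓ (w i) ∧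
    (∀ ξ : ℝ, (fhat (w i) ξ).im = 0 ∧ 0 ≤ (fhat (w i) ξ).re) ∧
    0 < (fhat (w i) 0).re

/-- Multiplicative height `H(m) = ∏ max(1,|mᵢ|)`. -/
noncomputable def Hmul {d : ℕ} (m : Fin d → ℝ) : ℝ := ∏ i, max 1 |m i|

/-- Distance from `x` to the nearest integer. -/
noncomputable def distInt (x : ℝ) : ℝ := |x - (round x : ℝ)|

/-- The constant 𝔠(ω) = ω̂₁(0)⋯ω̂_k(0). -/
noncomputable def smoothC {k : ℕ} (w : Fin k → ℝ → ℝ) : ℝ := ∏ i, (fhat (w i) 0).re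

/-- Smooth discrepancy of the Kronecker sequence of α in the box (γ; ρ) at scale N. -/
noncomputable def Dbox (d : ℕ) (w : Fin (d+1) → ℝ → ℝ) (α γ ρ : Fin d → ℝ) (N : ℝ) : ℝ :=
  (∑' p : (Fin d → ℤ) × ℤ,
      w (Fin.last d) ((p.2 : ℝ) / N) *
        ∏ i : Fin d, w i.castSucc (((p.1 i : ℝ) + (p.2 : ℝ) * α i - γ i) / ρ i))
    - smoothC w * ((∏ i, ρ i) * N)

/-- The point of the lattice `A ℤ^k` indexed by the integer vector `a`. -/
noncomputable def latPt {k : ℕ} (A : Matrix (Fin k) (Fin k) ℝ) (a : Fin k → ℤ) : Fin k → ℝ :=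
  A.mulVec (fun i => (a i : ℝ))

/-- The point of the dual lattice `(A⁻¹)ᵀ ℤ^k` indexed by the integer vector `a`. -/
noncomputable def dualPt {k : ℕ} (A : Matrix (Fin k) (Fin k) ℝ) (a : Fin k → ℤ) : Fin k → ℝ :=
  (A⁻¹).transpose.mulVec (fun i => (a i : ℝ))

/-- Smooth lattice discrepancy of the lattice `A ℤ^{d+1}` in the box (γ; ρ) at scale N. -/
noncomputable def DboxLat (d : ℕ) (A : Matrix (Fin (d+1)) (Fin (d+1)) ℝ)
    (w : Fin (d+1) → ℝ → ℝ) (γ ρ : Fin d → ℝ) (N : ℝ) : ℝ :=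
  (∑' a : Fin (d+1) → ℤ,
      w (Fin.last d) (latPt A a (Fin.last d) / N) *
        ∏ i : Fin d, w i.castSucc ((latPt A a i.castSucc - γ i) / ρ i))
    - smoothC w * ((∏ i, ρ i) * N)

/-- Side-length vector of a test box: each ρᵢ ∈ (0, 1/2). -/
def IsBox {d : ℕ} (ρ : Fin d → ℝ) : Prop := ∀ i, 0 < ρ i ∧ ρ i < 1/2

/-- Every nonzero dual lattice point (λ, λ_k) satisfies H(λ)·|λ_k| > 1/φ(H(λ)). -/
def DualBad (d : ℕ) (A : Matrix (Fin (d+1)) (Fin (d+1)) ℝ) (φ : ℝ → ℝ) : Prop :=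
  ∀ a : Fin (d+1) → ℤ, dualPt A a ≠ 0 →
    Hmul (fun i : Fin d => dualPt A a i.castSucc) * |dualPt A a (Fin.last d)| >
      1 / φ (Hmul (fun i : Fin d => dualPt A a i.castSucc))


section helpers
open MeasureTheory Filter Topology

theorem aux_expand1 (n : ℕ) (t : ℝ) :
    (((2 + 2 * Real.cos (2 * Real.pi * t)) ^ n : ℝ) : ℂ) =
      ∑ j ∈ Finset.range (2 * n + 1), ((2 * n).choose j : ℂ) *
        Complex.exp (2 * Real.pi * Complex.I * (((j : ℤ) - n : ℤ) : ℂ) * t) := by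
  set z : ℂ := Complex.exp (2 * Real.pi * Complex.I * t) with hz
  have hz0 : z ≠ 0 := Complex.exp_ne_zero _
  have h1 : ((2 + 2 * Real.cos (2 * Real.pi * t) : ℝ) : ℂ) = (z + 1) ^ 2 * z⁻¹ := by
    have h2 : ((Real.cos (2 * Real.pi * t) : ℝ) : ℂ) = (z + z⁻¹) / 2 := by
      rw [Complex.ofReal_cos, Complex.cos, hz, ← Complex.exp_neg]
      push_cast
      ring_nf
    push_cast at h2 ⊢
    rw [h2]
    field_simp
    ring
  rw [Complex.ofReal_pow, h1, mul_pow, ← pow_mul, add_pow, Finset.sum_mul]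
  refine Finset.sum_congr rfl fun j hj => ?_
  have h3 : Complex.exp (2 * Real.pi * Complex.I * (((j : ℤ) - n : ℤ) : ℂ) * t) = z ^ j * z⁻¹ ^ n := by
    rw [hz, ← Complex.exp_neg, ← Complex.exp_nat_mul, ← Complex.exp_nat_mul, ← Complex.exp_add]
    push_cast
    congr 1
    ring
  rw [h3]
  simp
  ring

theorem aux_int1 (n : ℕ) :
    ∫ t in Set.Icc (-(1/2) : ℝ) (1/2), (2 + 2 * Real.cos (2 * Real.pi * t)) ^ n
      = ((2 * n).choose n : ℝ) := by
  have key : ∀ m : ℤ, ∫ t in (-(1/2) : ℝ)..(1/2), Complex.exp (2 * Real.pi * Complex.I * (m : ℂ) * t)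
      = if m = 0 then 1 else 0 := by
    intro m
    split_ifs with h
    · subst h; norm_num
    · have hm : (2 * Real.pi * Complex.I * (m : ℂ)) ≠ 0 := by
        simp [h, Real.pi_ne_zero]
      rw [integral_exp_mul_complex hm]
      have : Complex.exp (2 * Real.pi * Complex.I * (m : ℂ) * ((1/2 : ℝ) : ℂ)) =
          Complex.exp (2 * Real.pi * Complex.I * (m : ℂ) * ((-(1/2) : ℝ) : ℂ)) := by
        rw [Complex.exp_eq_exp_iff_exists_int]
        refine ⟨m, ?_⟩
        push_cast
        ring
      rw [this]; simp
  rw [integral_Icc_eq_integral_Ioc, ← intervalIntegral.integral_of_le (by norm_num)]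
  apply Complex.ofReal_injective
  rw [← intervalIntegral.integral_ofReal]
  simp_rw [aux_expand1]
  rw [intervalIntegral.integral_finsetSum]
  · simp_rw [intervalIntegral.integral_const_mul, key]
    rw [Finset.sum_eq_single n]
    · simp
    · intro j _ hj
      rw [if_neg (by omega)]; simp
    · intro h; exact absurd (Finset.mem_range.2 (by omega)) h
  · intro j _
    apply Continuous.intervalIntegrable
    fun_prop

theorem aux_expand {k : ℕ} (n : ℕ) (t : Fin k → ℝ) :
    (∏ i, (2 + 2 * Real.cos (2 * Real.pi * t i))) ^ n =
      ∑ j ∈ Fintype.piFinset (fun _ : Fin k => Finset.range (2 * n + 1)),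
        (∏ i, ((2 * n).choose (j i) : ℝ)) *
          Real.cos (2 * Real.pi * ∑ i, (((j i : ℤ) - n : ℤ) : ℝ) * t i) := by
  have h : (((∏ i, (2 + 2 * Real.cos (2 * Real.pi * t i))) ^ n : ℝ) : ℂ) =
      ∑ j ∈ Fintype.piFinset (fun _ : Fin k => Finset.range (2 * n + 1)),
        ((∏ i, ((2 * n).choose (j i) : ℝ) : ℝ) : ℂ) *
          Complex.exp ((2 * Real.pi * ∑ i, (((j i : ℤ) - n : ℤ) : ℝ) * t i : ℝ) * Complex.I) := by
    rw [← Finset.prod_pow, Complex.ofReal_prod]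
    simp_rw [aux_expand1]
    rw [Finset.prod_univ_sum]
    refine Finset.sum_congr rfl fun j _ => ?_
    rw [Finset.prod_mul_distrib, ← Complex.exp_sum]
    push_cast
    congr 2
    rw [Finset.mul_sum, Finset.sum_mul]
    refine Finset.sum_congr rfl fun i _ => ?_
    ring
  have h2 := congrArg Complex.re h
  rw [Complex.ofReal_re, Complex.re_sum] at h2
  rw [h2]
  refine Finset.sum_congr rfl fun j _ => ?_
  rw [Complex.re_ofReal_mul, Complex.exp_ofReal_mul_I_re]

theorem aux_ratio_nat (m : ℕ) :
    Tendsto (fun n : ℕ => ((2 * n).choose (n + m) : ℝ) / ((2 * n).choose n : ℝ)) atTop (𝓝 1) := by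
  induction m with
  | zero =>
    refine tendsto_const_nhds.congr fun n => ?_
    have : ((2 * n).choose n : ℝ) ≠ 0 := by
      exact_mod_cast (Nat.choose_pos (by omega)).ne'
    rw [add_zero, div_self this]
  | succ m ih =>
    have h1 : Tendsto (fun n : ℕ => ((n : ℝ) - m) / (n + m + 1)) atTop (𝓝 1) := by
      have h2 : Tendsto (fun n : ℕ => 1 - (2 * m + 1 : ℝ) / ((n : ℝ) + (m + 1))) atTop (𝓝 (1 - 0)) := by
        refine tendsto_const_nhds.sub (Tendsto.div_atTop tendsto_const_nhds ?_)
        exact tendsto_atTop_add_const_right _ _ tendsto_natCast_atTop_atTop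
      rw [sub_zero] at h2
      refine h2.congr fun n => ?_
      have : (n : ℝ) + (m + 1) ≠ 0 := by positivity
      have : (n : ℝ) + m + 1 ≠ 0 := by positivity
      field_simp
      ring
    have h3 := ih.mul h1
    rw [one_mul] at h3
    refine h3.congr' ?_
    filter_upwards [eventually_ge_atTop m] with n hn
    have h4 := Nat.choose_succ_right_eq (2 * n) (n + m)
    have h5 : ((2 * n).choose (n + m + 1) : ℝ) * (n + m + 1) = (2 * n).choose (n + m) * (n - m) := by
      have : 2 * n - (n + m) = n - m := by omega
      rw [this] at h4
      have := congrArg (Nat.cast : ℕ → ℝ) h4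
      push_cast [Nat.cast_sub hn] at this
      exact this
    have : (n : ℝ) + m + 1 ≠ 0 := by positivity
    have h6 : ((2 * n).choose n : ℝ) ≠ 0 := by
      exact_mod_cast (Nat.choose_pos (by omega)).ne'
    rw [← add_assoc]
    field_simp
    linarith

theorem aux_ratio (m : ℤ) :
    Tendsto (fun n : ℕ => ((2 * n).choose ((n + m : ℤ).toNat) : ℝ) / ((2 * n).choose n : ℝ))
      atTop (𝓝 1) := by
  obtain ⟨p, rfl | rfl⟩ := m.eq_nat_or_neg
  · refine (aux_ratio_nat p).congr fun n => ?_
    norm_cast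
  · refine (aux_ratio_nat p).congr' ?_
    filter_upwards [eventually_ge_atTop p] with n hn
    have h1 : ((n : ℤ) + -(p : ℤ)).toNat = n - p := by omega
    rw [h1]
    have h2 : (2 * n).choose (n + p) = (2 * n).choose (n - p) := by
      rw [← Nat.choose_symm (show n + p ≤ 2 * n by omega)]
      congr 1; omega
    rw [h2]

theorem aux_Z {k : ℕ} (n : ℕ) :
    ∫ t in Set.Icc (fun _ : Fin k => (-(1/2) : ℝ)) (fun _ => 1/2),
      (∏ i, (2 + 2 * Real.cos (2 * Real.pi * t i))) ^ n = ((2 * n).choose n : ℝ) ^ k := by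
  rw [← Set.pi_univ_Icc, volume_pi, Measure.restrict_pi_pi]
  simp_rw [← Finset.prod_pow]
  rw [integral_fintype_prod_eq_prod (fun _ (x : ℝ) => (2 + 2 * Real.cos (2 * Real.pi * x)) ^ n)]
  simp_rw [aux_int1]
  simp

theorem aux_peak {k : ℕ} (g : (Fin k → ℝ) → ℝ) (hg : Continuous g) :
    Tendsto (fun n : ℕ => (((2 * n).choose n : ℝ) ^ k)⁻¹ *
      ∫ t in Set.Icc (fun _ : Fin k => (-(1/2) : ℝ)) (fun _ => 1/2),
        (∏ i, (2 + 2 * Real.cos (2 * Real.pi * t i))) ^ n * g t) atTop (𝓝 (g 0)) := by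
  have h := tendsto_setIntegral_pow_smul_of_unique_maximum_of_isCompact_of_continuousOn
    (μ := volume) (s := Set.Icc (fun _ : Fin k => (-(1/2) : ℝ)) (fun _ => 1/2)) (x₀ := 0) (g := g)
    (c := fun t => ∏ i, (2 + 2 * Real.cos (2 * Real.pi * t i))) isCompact_Icc
    (by fun_prop) ?_ ?_ ?_ ?_ hg.continuousOn
  · simp_rw [aux_Z, smul_eq_mul] at h
    exact h
  · intro y hy hy0
    obtain ⟨i, hi⟩ : ∃ i, y i ≠ 0 := Function.ne_iff.1 hy0
    have hle : ∀ j, 2 + 2 * Real.cos (2 * Real.pi * y j) ≤ 4 := fun j => by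
      linarith [Real.cos_le_one (2 * Real.pi * y j)]
    have hnn : ∀ j, 0 ≤ 2 + 2 * Real.cos (2 * Real.pi * y j) := fun j => by
      linarith [Real.neg_one_le_cos (2 * Real.pi * y j)]
    have hlt : 2 + 2 * Real.cos (2 * Real.pi * y i) < 4 := by
      have h1 : Real.cos (2 * Real.pi * y i) ≠ 1 := by
        intro h1
        have a1 : -(1/2) ≤ y i := hy.1 i
        have a2 : y i ≤ 1/2 := hy.2 i
        rw [Real.cos_eq_one_iff_of_lt_of_lt (by nlinarith [Real.pi_pos]) (by nlinarith [Real.pi_pos])] at h1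
        simp [Real.pi_ne_zero, hi] at h1
      have h2 := lt_of_le_of_ne (Real.cos_le_one (2 * Real.pi * y i)) h1
      linarith
    simp only [Pi.zero_apply, mul_zero, Real.cos_zero]
    rw [← Finset.mul_prod_erase _ _ (Finset.mem_univ i),
      ← Finset.mul_prod_erase _ (fun _ => (2 + 2 * 1 : ℝ)) (Finset.mem_univ i)]
    have hP : ∏ x ∈ Finset.univ.erase i, (2 + 2 * Real.cos (2 * Real.pi * y x)) ≤
        ∏ x ∈ Finset.univ.erase i, (2 + 2 * 1 : ℝ) :=
      Finset.prod_le_prod (fun j _ => hnn j) (fun j _ => by linarith [hle j])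
    have hP0 : 0 < ∏ x ∈ Finset.univ.erase i, (2 + 2 * 1 : ℝ) :=
      Finset.prod_pos fun _ _ => by norm_num
    exact lt_of_le_of_lt (mul_le_mul_of_nonneg_left hP (hnn i))
      (mul_lt_mul_of_pos_right (by linarith) hP0)
  · intro x _
    exact Finset.prod_nonneg fun j _ => by linarith [Real.neg_one_le_cos (2 * Real.pi * x j)]
  · simp only [Pi.zero_apply, mul_zero, Real.cos_zero]
    positivity
  · apply subset_closure
    rw [← Set.pi_univ_Icc, interior_pi_set Set.finite_univ]
    intro i _
    simp

theorem aux_unfold {k : ℕ} (G : (Fin k → ℝ) → ℝ) (hG : Continuous G) (hs : HasCompactSupport G) :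
    Tendsto (fun n : ℕ => (((2 * n).choose n : ℝ) ^ k)⁻¹ *
      ∫ t, (∏ i, (2 + 2 * Real.cos (2 * Real.pi * t i))) ^ n * G t) atTop
      (𝓝 (∑' a : Fin k → ℤ, G (fun i => (a i : ℝ)))) := by
  obtain ⟨R, hR⟩ : ∃ R : ℝ, ∀ t, G t ≠ 0 → ‖t‖ ≤ R := by
    obtain ⟨R, hR⟩ := hs.isCompact.isBounded.exists_norm_le
    exact ⟨R, fun t ht => hR t (subset_tsupport _ ht)⟩
  set S : Finset (Fin k → ℤ) := Fintype.piFinset (fun _ => Finset.Icc (-⌈R + 1⌉) ⌈R + 1⌉) with hS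
  have hSz : ∀ a : Fin k → ℤ, a ∉ S → ∀ t : Fin k → ℝ, (∀ i, |t i| ≤ 1/2) →
      G (t + fun i => (a i : ℝ)) = 0 := by
    intro a ha t ht
    by_contra hne
    apply ha
    have h1 := hR _ hne
    rw [hS, Fintype.mem_piFinset]
    intro i
    have h2 := (norm_le_pi_norm (t + fun i => (a i : ℝ)) i).trans h1
    rw [Real.norm_eq_abs, Pi.add_apply] at h2
    have h3 := abs_le.1 h2
    have h4 := abs_le.1 (ht i)
    have h5 := Int.le_ceil (R + 1)
    rw [Finset.mem_Icc]
    constructor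
    · have : (-(⌈R+1⌉ : ℝ)) ≤ a i := by linarith [h3.1, h4.2]
      exact_mod_cast this
    · have : (a i : ℝ) ≤ ⌈R+1⌉ := by linarith [h3.2, h4.1]
      exact_mod_cast this
  have htsum : ∑' a : Fin k → ℤ, G (fun i => (a i : ℝ)) =
      ∑ a ∈ S, G (0 + fun i => (a i : ℝ)) := by
    rw [tsum_eq_sum (s := S)]
    · simp
    · intro a ha
      simpa using hSz a ha 0 (by intro i; simp)
  rw [htsum]
  have hint : ∀ n : ℕ, ∫ t, (∏ i, (2 + 2 * Real.cos (2 * Real.pi * t i))) ^ n * G t =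
      ∑ a ∈ S, ∫ t in Set.Icc (fun _ : Fin k => (-(1/2) : ℝ)) (fun _ => 1/2),
        (∏ i, (2 + 2 * Real.cos (2 * Real.pi * t i))) ^ n * G (t + fun i => (a i : ℝ)) := by
    intro n
    set F : (Fin k → ℝ) → ℝ :=
      fun t => (∏ i, (2 + 2 * Real.cos (2 * Real.pi * t i))) ^ n * G t with hF
    have hFi : Integrable F := by
      apply Continuous.integrable_of_hasCompactSupport
      · rw [hF]; fun_prop
      · exact hs.mul_left
    set Q : (Fin k → ℤ) → Set (Fin k → ℝ) := fun a =>
      Set.univ.pi (fun i => Set.Ico ((a i : ℝ) - 1/2) (a i + 1/2)) with hQ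
    have hQm : ∀ a, MeasurableSet (Q a) := fun a => by
      exact MeasurableSet.univ_pi fun i => measurableSet_Ico
    have hfl : ∀ (a : ℤ) (x : ℝ), x ∈ Set.Ico ((a : ℝ) - 1/2) (a + 1/2) ↔ ⌊x + 1/2⌋ = a := by
      intro a x
      rw [Int.floor_eq_iff, Set.mem_Ico]
      constructor <;> rintro ⟨h1, h2⟩ <;> constructor <;> linarith
    have hQd : Pairwise (Function.onFun Disjoint Q) := by
      intro a b hab
      rw [Function.onFun, Set.disjoint_left]
      intro t h1 h2
      apply hab
      funext i
      rw [← (hfl _ _).1 (h1 i trivial), ← (hfl _ _).1 (h2 i trivial)]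
    have hQu : ⋃ a, Q a = Set.univ := by
      rw [Set.eq_univ_iff_forall]
      intro t
      rw [Set.mem_iUnion]
      exact ⟨fun i => ⌊t i + 1/2⌋, fun i _ => (hfl _ _).2 rfl⟩
    have hQi : ∀ a, ∫ t in Q a, F t = ∫ t in Set.Icc (fun _ : Fin k => (-(1/2) : ℝ)) (fun _ => 1/2),
        (∏ i, (2 + 2 * Real.cos (2 * Real.pi * t i))) ^ n * G (t + fun i => (a i : ℝ)) := by
      intro a
      have hmp := measurePreserving_add_right (volume : Measure (Fin k → ℝ)) (fun i => (a i : ℝ))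
      rw [← hmp.setIntegral_preimage_emb (measurableEmbedding_addRight _)]
      have hpre : (fun x : Fin k → ℝ => x + fun i => (a i : ℝ)) ⁻¹' Q a =
          Set.univ.pi (fun _ => Set.Ico (-(1/2) : ℝ) (1/2)) := by
        ext x
        simp only [hQ, Set.mem_preimage, Set.mem_univ_pi, Pi.add_apply, Set.mem_Ico]
        refine forall_congr' fun i => ?_
        constructor <;> rintro ⟨h1, h2⟩ <;> constructor <;> linarith
      have hae : Set.univ.pi (fun _ : Fin k => Set.Ico (-(1/2) : ℝ) (1/2)) =ᵐ[volume]
          Set.Icc (fun _ : Fin k => (-(1/2) : ℝ)) (fun _ => 1/2) :=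
        Measure.univ_pi_Ico_ae_eq_Icc (μ := fun _ : Fin k => (volume : Measure ℝ))
      rw [hpre, setIntegral_congr_set hae]
      refine integral_congr_ae (Eventually.of_forall fun t => ?_)
      simp only [hF, Pi.add_apply]
      congr 2
      refine Finset.prod_congr rfl fun i _ => ?_
      have : 2 * Real.pi * (t i + a i) = 2 * Real.pi * t i + a i * (2 * Real.pi) := by ring
      rw [this, Real.cos_add_int_mul_two_pi]
    have h1 := integral_iUnion hQm hQd (f := F) (μ := volume) hFi.integrableOn
    rw [hQu, setIntegral_univ] at h1
    rw [h1]
    simp_rw [hQi]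
    apply tsum_eq_sum
    intro a ha
    rw [setIntegral_congr_fun measurableSet_Icc (g := fun _ => 0)]
    · simp
    · intro t ht
      have := hSz a ha t (fun i => abs_le.2 ⟨ht.1 i, ht.2 i⟩)
      simp only [this, mul_zero]
  simp_rw [hint, Finset.mul_sum]
  refine tendsto_finsetSum _ fun a _ => ?_
  exact aux_peak (fun t => G (t + fun i => (a i : ℝ))) (by fun_prop)

theorem aux_poisson {k : ℕ} (G : (Fin k → ℝ) → ℝ) (hG : Continuous G) (hs : HasCompactSupport G)
    (hpos : ∀ m : Fin k → ℤ, 0 ≤ ∫ t, Real.cos (2 * Real.pi * ∑ i, (m i : ℝ) * t i) * G t)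
    (μ : Fin k → ℤ) (hμ : μ ≠ 0) :
    (∫ t, G t) + ∫ t, Real.cos (2 * Real.pi * ∑ i, (μ i : ℝ) * t i) * G t ≤
      ∑' a : Fin k → ℤ, G (fun i => (a i : ℝ)) := by
  set I : (Fin k → ℤ) → ℝ := fun m => ∫ t, Real.cos (2 * Real.pi * ∑ i, (m i : ℝ) * t i) * G t with hI
  have hI0 : ∫ t, G t = I 0 := by simp [hI]
  rw [hI0]
  change I 0 + I μ ≤ _
  have hlim : Tendsto (fun n : ℕ => I 0 +
      (∏ i, ((2 * n).choose ((n + μ i : ℤ).toNat) : ℝ) / ((2 * n).choose n : ℝ)) * I μ) atTop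
      (𝓝 (I 0 + (∏ i : Fin k, (1 : ℝ)) * I μ)) :=
    tendsto_const_nhds.add ((tendsto_finsetProd _ fun i _ => aux_ratio (μ i)).mul_const _)
  simp only [Finset.prod_const_one, one_mul] at hlim
  refine le_of_tendsto_of_tendsto hlim (aux_unfold G hG hs) ?_
  obtain ⟨B, hB⟩ : ∃ B : ℕ, ∀ i, (μ i).natAbs ≤ B :=
    ⟨∑ i, (μ i).natAbs, fun i => Finset.single_le_sum (f := fun i => (μ i).natAbs)
      (fun _ _ => Nat.zero_le _) (Finset.mem_univ i)⟩
  filter_upwards [eventually_ge_atTop B] with n hn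
  have hexp : ∫ t, (∏ i, (2 + 2 * Real.cos (2 * Real.pi * t i))) ^ n * G t =
      ∑ j ∈ Fintype.piFinset (fun _ : Fin k => Finset.range (2 * n + 1)),
        (∏ i, ((2 * n).choose (j i) : ℝ)) * I (fun i => (j i : ℤ) - n) := by
    simp_rw [aux_expand, Finset.sum_mul]
    rw [integral_finsetSum]
    · refine Finset.sum_congr rfl fun j _ => ?_
      simp_rw [mul_assoc]
      rw [integral_const_mul]
      simp only [hI, mul_assoc]
    · intro j _
      apply Continuous.integrable_of_hasCompactSupport
      · fun_prop
      · exact hs.mul_left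
  have hC : (0 : ℝ) < ((2 * n).choose n : ℝ) := by
    exact_mod_cast Nat.choose_pos (by omega)
  rw [hexp]
  set j0 : Fin k → ℕ := fun _ => n with hj0
  set j1 : Fin k → ℕ := fun i => (n + μ i : ℤ).toNat with hj1
  have hj1c : ∀ i, ((j1 i : ℕ) : ℤ) = n + μ i := fun i => by
    have := hB i
    simp only [hj1]
    omega
  have hne : j0 ≠ j1 := by
    intro h
    apply hμ
    funext i
    have h1 := hj1c i
    rw [← h] at h1
    simp only [hj0] at h1
    simp only [Pi.zero_apply]
    omega
  have hsub : ({j0, j1} : Finset (Fin k → ℕ)) ⊆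
      Fintype.piFinset (fun _ : Fin k => Finset.range (2 * n + 1)) := by
    intro j hj
    rw [Finset.mem_insert, Finset.mem_singleton] at hj
    rw [Fintype.mem_piFinset]
    intro i
    rw [Finset.mem_range]
    rcases hj with rfl | rfl
    · simp only [hj0]; omega
    · have := hj1c i
      have := hB i
      omega
  have hle := Finset.sum_le_sum_of_subset_of_nonneg
    (f := fun j : Fin k → ℕ => (∏ i, ((2 * n).choose (j i) : ℝ)) * I (fun i => (j i : ℤ) - n)) hsub
    (fun j _ _ => mul_nonneg (Finset.prod_nonneg fun _ _ => by positivity) (hpos _))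
  rw [Finset.sum_pair hne] at hle
  have e0 : (fun i => ((j0 i : ℕ) : ℤ) - n) = 0 := by funext i; simp [hj0]
  have e1 : (fun i => ((j1 i : ℕ) : ℤ) - n) = μ := by funext i; rw [hj1c]; ring
  rw [e0, e1] at hle
  refine le_trans (le_of_eq ?_) (mul_le_mul_of_nonneg_left hle (by positivity))
  rw [Finset.prod_div_distrib]
  simp only [hj0, hj1, Finset.prod_const, Finset.card_univ, Fintype.card_fin]
  field_simp

theorem aux_cs {w : ℝ → ℝ} (hsupp : Function.support w ⊆ Set.Icc (-2 : ℝ) 2) :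
    HasCompactSupport w :=
  HasCompactSupport.of_support_subset_isCompact isCompact_Icc hsupp

theorem aux_fhat_cont {w : ℝ → ℝ} (hc : Continuous w)
    (hsupp : Function.support w ⊆ Set.Icc (-2 : ℝ) 2) : Continuous (fhat w) := by
  have hi : Integrable w := hc.integrable_of_hasCompactSupport (aux_cs hsupp)
  unfold fhat
  apply continuous_of_dominated (bound := fun x => ‖w x‖)
  · intro ξ
    apply Continuous.aestronglyMeasurable
    fun_prop
  · intro ξ
    refine Eventually.of_forall fun x => ?_
    rw [norm_mul, Complex.norm_real]
    have : -(2 * Real.pi * Complex.I * ξ * x) = ((-(2 * Real.pi * ξ * x) : ℝ) : ℂ) * Complex.I := by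
      push_cast; ring
    rw [this, Complex.norm_exp_ofReal_mul_I, mul_one]
  · exact hi.norm
  · refine Eventually.of_forall fun x => ?_
    fun_prop

theorem aux_scale (w : ℝ → ℝ) (r : ℝ) (hr : 0 < r) (ξ : ℝ) :
    ∫ x : ℝ, (w (x / r) : ℂ) * Complex.exp (-(2 * Real.pi * Complex.I * ξ * x)) =
      r * fhat w (r * ξ) := by
  have h := Measure.integral_comp_div
    (fun y : ℝ => (w y : ℂ) * Complex.exp (-(2 * Real.pi * Complex.I * ((r * ξ : ℝ) : ℂ) * y))) r
  rw [abs_of_pos hr] at h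
  unfold fhat
  rw [Complex.real_smul] at h
  rw [← h]
  refine integral_congr_ae (Eventually.of_forall fun x => ?_)
  have hr' : (r : ℂ) ≠ 0 := by exact_mod_cast hr.ne'
  simp only
  congr 2
  push_cast
  field_simp

theorem aux_cov {k : ℕ} (A : Matrix (Fin k) (Fin k) ℝ) (hdet : |A.det| = 1)
    (f : (Fin k → ℝ) → ℂ) (hf : Continuous f) :
    ∫ t, f (A.mulVec t) = ∫ x, f x := by
  have hd : A.det ≠ 0 := by
    intro h; rw [h] at hdet; simp at hdet
  have h := Real.map_matrix_volume_pi_eq_smul_volume_pi hd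
  rw [abs_inv, hdet, inv_one, ENNReal.ofReal_one, one_smul] at h
  have h2 := integral_map (μ := (volume : Measure (Fin k → ℝ))) (φ := Matrix.toLin' A)
    (f := f) (by
      apply Continuous.aemeasurable
      exact LinearMap.continuous_of_finiteDimensional _) hf.aestronglyMeasurable
  rw [h] at h2
  rw [h2]
  rfl

theorem aux_fourier {k ℓ : ℕ} (w : Fin k → ℝ → ℝ) (hw : GoodWeights k ℓ w)
    (A : Matrix (Fin k) (Fin k) ℝ) (hdet : |A.det| = 1) (r : Fin k → ℝ) (hr : ∀ i, 0 < r i)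
    (hcs : HasCompactSupport (fun t : Fin k → ℝ => ∏ i, w i (A.mulVec t i / r i)))
    (m : Fin k → ℤ) :
    ∫ t : Fin k → ℝ, Real.cos (2 * Real.pi * ∑ i, (m i : ℝ) * t i) *
        ∏ i, w i (A.mulVec t i / r i) =
      ∏ i, (r i * (fhat (w i) (r i * dualPt A m i)).re) := by
  have hwc : ∀ i, Continuous (w i) := fun i => (hw i).2.2.1.continuous
  have hAc : Continuous (fun t : Fin k → ℝ => A.mulVec t) :=
    Continuous.matrix_mulVec continuous_const continuous_id
  have hd : IsUnit A.det := by
    rw [isUnit_iff_ne_zero]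
    intro h; rw [h] at hdet; simp at hdet
  have hdot : ∀ t : Fin k → ℝ, ∑ i, (m i : ℝ) * t i = ∑ i, dualPt A m i * A.mulVec t i := by
    intro t
    change (fun i => (m i : ℝ)) ⬝ᵥ t = dualPt A m ⬝ᵥ A.mulVec t
    rw [dualPt, Matrix.mulVec_transpose, ← Matrix.dotProduct_mulVec, Matrix.mulVec_mulVec,
      Matrix.nonsing_inv_mul _ hd, Matrix.one_mulVec]
  have h1 : ∫ t : Fin k → ℝ, Complex.exp (-(2 * Real.pi * Complex.I * ((∑ i, (m i : ℝ) * t i : ℝ) : ℂ)))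
        * ((∏ i, w i (A.mulVec t i / r i) : ℝ) : ℂ) =
      ((∏ i, (r i * (fhat (w i) (r i * dualPt A m i)).re) : ℝ) : ℂ) := by
    have h2 := aux_cov A hdet (fun x => ∏ i, ((w i (x i / r i) : ℂ) *
      Complex.exp (-(2 * Real.pi * Complex.I * (dualPt A m i : ℂ) * x i)))) (by fun_prop)
    rw [integral_fintype_prod_volume_eq_prod (fun i (x : ℝ) => ((w i (x / r i) : ℂ) *
      Complex.exp (-(2 * Real.pi * Complex.I * (dualPt A m i : ℂ) * x))))] at h2
    simp_rw [fun i => aux_scale (w i) (r i) (hr i) (dualPt A m i)] at h2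
    rw [Complex.ofReal_prod]
    refine Eq.trans ?_ (h2.trans ?_)
    · refine integral_congr_ae (Eventually.of_forall fun t => ?_)
      simp only
      rw [Finset.prod_mul_distrib, ← Complex.exp_sum, hdot t, mul_comm]
      push_cast
      congr 2
      rw [Finset.mul_sum, ← Finset.sum_neg_distrib]
      refine Finset.sum_congr rfl fun i _ => ?_
      ring
    · refine Finset.prod_congr rfl fun i _ => ?_
      rw [Complex.ofReal_mul]
      congr 1
      apply Complex.ext
      · simp
      · simp [((hw i).2.2.2.1 _).1]
  have hint : Integrable (fun t : Fin k → ℝ =>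
      Complex.exp (-(2 * Real.pi * Complex.I * ((∑ i, (m i : ℝ) * t i : ℝ) : ℂ)))
        * ((∏ i, w i (A.mulVec t i / r i) : ℝ) : ℂ)) := by
    apply Continuous.integrable_of_hasCompactSupport
    · fun_prop
    · apply HasCompactSupport.mul_left
      exact hcs.comp_left (g := fun x : ℝ => (x : ℂ)) Complex.ofReal_zero
  have h3 := congrArg Complex.re h1
  rw [Complex.ofReal_re] at h3
  rw [← h3, ← RCLike.re_eq_complex_re, ← integral_re hint]
  refine integral_congr_ae (Eventually.of_forall fun t => ?_)
  simp only [RCLike.re_eq_complex_re]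
  rw [Complex.re_mul_ofReal]
  congr 1
  have : -(2 * Real.pi * Complex.I * ((∑ i, (m i : ℝ) * t i : ℝ) : ℂ)) =
      ((-(2 * Real.pi * ∑ i, (m i : ℝ) * t i) : ℝ) : ℂ) * Complex.I := by
    push_cast; ring
  rw [this, Complex.exp_ofReal_mul_I_re, Real.cos_neg]

/-- Lower bound for the lattice sum by the zero frequency and one further frequency. -/
theorem aux_lattice {k ℓ : ℕ} (w : Fin k → ℝ → ℝ) (hw : GoodWeights k ℓ w)
    (A : Matrix (Fin k) (Fin k) ℝ) (hdet : |A.det| = 1) (r : Fin k → ℝ) (hr : ∀ i, 0 < r i)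
    (μ : Fin k → ℤ) (hμ : μ ≠ 0) :
    ∏ i, (r i * (fhat (w i) 0).re) + ∏ i, (r i * (fhat (w i) (r i * dualPt A μ i)).re) ≤
      ∑' a : Fin k → ℤ, ∏ i, w i (latPt A a i / r i) := by
  have hwc : ∀ i, Continuous (w i) := fun i => (hw i).2.2.1.continuous
  have hAc : Continuous (fun t : Fin k → ℝ => A.mulVec t) :=
    Continuous.matrix_mulVec continuous_const continuous_id
  have hd : IsUnit A.det := by
    rw [isUnit_iff_ne_zero]
    intro h; rw [h] at hdet; simp at hdet
  have hcs : HasCompactSupport (fun t : Fin k → ℝ => ∏ i, w i (A.mulVec t i / r i)) := by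
    have hK : IsCompact ((fun x : Fin k → ℝ => A⁻¹.mulVec x) ''
        (Set.Icc (fun i => -2 * r i) (fun i => 2 * r i))) :=
      isCompact_Icc.image (Continuous.matrix_mulVec continuous_const continuous_id)
    refine HasCompactSupport.of_support_subset_isCompact hK fun t ht => ?_
    refine ⟨A.mulVec t, ?_, ?_⟩
    · have h1 : ∀ i, w i (A.mulVec t i / r i) ≠ 0 := by
        intro i
        exact Finset.prod_ne_zero_iff.1 ht i (Finset.mem_univ i)
      have h2 := fun i => (hw i).2.1 (h1 i)
      constructor
      · intro i
        exact (le_div_iff₀ (hr i)).1 (h2 i).1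
      · intro i
        exact (div_le_iff₀ (hr i)).1 (h2 i).2
    · simp only [Matrix.mulVec_mulVec, Matrix.nonsing_inv_mul _ hd, Matrix.one_mulVec]
  have hF := aux_fourier w hw A hdet r hr hcs
  have h := aux_poisson (fun t : Fin k → ℝ => ∏ i, w i (A.mulVec t i / r i)) (by fun_prop) hcs
    (fun m => by
      rw [hF m]
      exact Finset.prod_nonneg fun i _ => mul_nonneg (hr i).le ((hw i).2.2.2.1 _).2) μ hμ
  rw [hF μ] at h
  have h0 := hF 0
  have hz : dualPt A 0 = 0 := by
    unfold dualPt
    simp only [Pi.zero_apply, Int.cast_zero]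
    exact Matrix.mulVec_zero _
  rw [hz] at h0
  simp only [Pi.zero_apply, Int.cast_zero, zero_mul, Finset.sum_const_zero, mul_zero, Real.cos_zero,
    one_mul] at h0
  rw [h0] at h
  exact h

theorem aux_finite {k : ℕ} (A : Matrix (Fin k) (Fin k) ℝ) (hdet : |A.det| = 1) (K : ℝ) :
    {a : Fin k → ℤ | ∀ i, |dualPt A a i| ≤ K}.Finite := by
  have hd : IsUnit A.det := by
    rw [isUnit_iff_ne_zero]
    intro h; rw [h] at hdet; simp at hdet
  have hK : IsCompact ((fun x : Fin k → ℝ => A.transpose.mulVec x) ''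
        (Set.Icc (fun _ => -K) (fun _ => K))) :=
      isCompact_Icc.image (Continuous.matrix_mulVec continuous_const continuous_id)
  obtain ⟨R, hR⟩ := hK.isBounded.exists_norm_le
  refine (Set.Finite.pi' (t := fun _ : Fin k => Set.Icc (-⌈R⌉) ⌈R⌉)
    fun _ => Set.finite_Icc _ _).subset fun a ha => ?_
  intro i
  have h1 : A.transpose.mulVec (dualPt A a) = fun i => (a i : ℝ) := by
    rw [dualPt, Matrix.mulVec_mulVec, ← Matrix.transpose_mul, Matrix.nonsing_inv_mul _ hd,
      Matrix.transpose_one, Matrix.one_mulVec]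
  have h2 := hR _ ⟨dualPt A a, ⟨fun i => (abs_le.1 (ha i)).1, fun i => (abs_le.1 (ha i)).2⟩, rfl⟩
  simp only [h1] at h2
  have h3 := (norm_le_pi_norm (fun i => (a i : ℝ)) i).trans h2
  rw [Real.norm_eq_abs] at h3
  have h4 := abs_le.1 h3
  have h5 := Int.le_ceil R
  constructor
  · have : (-(⌈R⌉ : ℝ)) ≤ a i := by linarith [h4.1]
    exact_mod_cast this
  · have : (a i : ℝ) ≤ ⌈R⌉ := by linarith [h4.2]
    exact_mod_cast this

theorem aux_delta {k ℓ : ℕ} (w : Fin k → ℝ → ℝ) (hw : GoodWeights k ℓ w) :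
    ∃ δ : ℝ, 0 < δ ∧ δ < 1/2 ∧ ∀ i, ∀ ξ : ℝ, |ξ| ≤ δ →
      (fhat (w i) 0).re / 2 ≤ (fhat (w i) ξ).re := by
  have h : ∀ᶠ ξ : ℝ in 𝓝 0, ∀ i, (fhat (w i) 0).re / 2 < (fhat (w i) ξ).re := by
    rw [eventually_all]
    intro i
    have hc : Continuous (fun ξ => (fhat (w i) ξ).re) :=
      Complex.continuous_re.comp (aux_fhat_cont (hw i).2.2.1.continuous (hw i).2.1)
    have := (hw i).2.2.2.2
    exact hc.continuousAt.eventually (lt_mem_nhds (by linarith))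
  obtain ⟨ε, hε, h1⟩ := Metric.eventually_nhds_iff.1 h
  refine ⟨min (ε / 2) (1 / 4), by positivity, lt_of_le_of_lt (min_le_right _ _) (by norm_num), ?_⟩
  intro i ξ hξ
  refine (h1 ?_ i).le
  rw [Real.dist_eq, sub_zero]
  have := min_le_left (ε / 2) (1 / 4 : ℝ)
  linarith

end helpers

/-- Theorem: smooth lattice discrepancy lower bound. -/
theorem smooth_discrepancy_lower_lattice
    (d : ℕ) (hd : 1 ≤ d) (ℓ : ℕ) (hℓ : 2 ≤ ℓ)
    (w : Fin (d+1) → ℝ → ℝ) (hw : GoodWeights (d+1) ℓ w)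
    (A : Matrix (Fin (d+1)) (Fin (d+1)) ℝ) (hdet : |A.det| = 1)
    (φ L : ℝ → ℝ)
    (hφmap : ∀ x, 1 ≤ x → 1 ≤ φ x)
    (hφmono : ∀ x y, 1 ≤ x → x ≤ y → φ x ≤ φ y)
    (hinf : {a : Fin (d+1) → ℤ |
      Hmul (fun i : Fin d => dualPt A a i.castSucc) * |dualPt A a (Fin.last d)| <
        1 / φ (Hmul (fun i : Fin d => dualPt A a i.castSucc))}.Infinite)
    (hLmap : ∀ x, φ 1 ≤ x → 1 ≤ L x)
    (hLdef : ∀ x, φ 1 ≤ x → L x * φ (L x) = x) :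
    ∃ c : ℝ, 0 < c ∧ ∀ M : ℝ, ∃ N : ℕ, M ≤ (N : ℝ) ∧ φ 1 ≤ (N : ℝ) ∧
      ∃ γ ρ : Fin d → ℝ, IsBox ρ ∧ c * φ (L N) ≤ |DboxLat d A w γ ρ N| := by
  obtain ⟨δ, hδ0, hδ1, hδ⟩ := aux_delta w hw
  have hCpos : 0 < smoothC w := Finset.prod_pos fun i _ => (hw i).2.2.2.2
  refine ⟨smoothC w / 2 ^ (d + 1) * δ ^ d * (δ / 2), by positivity, fun M => ?_⟩
  -- choose a dual point of large height
  set K : ℝ := (|M| + φ 1 + 2) / δ with hK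
  have hφ1 := hφmap 1 le_rfl
  have hKpos : 0 < K := by positivity
  obtain ⟨a, ha, haK⟩ := (hinf.sdiff (aux_finite A hdet (K + 1))).nonempty
  set ξ := dualPt A a with hξ
  set H : ℝ := Hmul (fun i : Fin d => ξ i.castSucc) with hH
  have hfac : ∀ i : Fin d, 1 ≤ max 1 |ξ i.castSucc| := fun i => le_max_left _ _
  have hH1 : 1 ≤ H := Finset.one_le_prod fun i _ => hfac i
  have hHi : ∀ i : Fin d, |ξ i.castSucc| ≤ H := by
    intro i
    refine (le_max_right 1 _).trans ?_
    rw [hH, Hmul, ← Finset.mul_prod_erase _ _ (Finset.mem_univ i)]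
    refine le_mul_of_one_le_right (by linarith [hfac i]) ?_
    exact Finset.one_le_prod fun i _ => hfac i
  have hφH := hφmap H hH1
  replace ha : H * |ξ (Fin.last d)| < 1 / φ H := ha
  have hsmall : H * φ H * |ξ (Fin.last d)| < 1 := by
    rw [lt_div_iff₀ (by linarith)] at ha
    linarith
  have hHK : K < H := by
    by_contra hle
    push Not at hle
    apply haK
    intro i
    refine Fin.lastCases ?_ (fun j => ?_) i
    · have : 1 * |ξ (Fin.last d)| ≤ H * φ H * |ξ (Fin.last d)| :=
        mul_le_mul_of_nonneg_right (by nlinarith) (abs_nonneg _)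
      rw [← hξ]
      linarith
    · have := hHi j
      rw [← hξ]
      linarith
  have ha0 : a ≠ 0 := by
    rintro rfl
    apply haK
    intro i
    have : dualPt A 0 = 0 := by
      unfold dualPt
      simp only [Pi.zero_apply, Int.cast_zero]
      exact Matrix.mulVec_zero _
    rw [this, Pi.zero_apply, abs_zero]
    linarith
  set X : ℝ := δ * (H * φ H) with hX
  have hXbig : |M| + φ 1 + 2 < X := by
    have h1 : K ≤ H * φ H := by nlinarith
    have h2 : K < H * φ H := by nlinarith
    rw [hK, div_lt_iff₀ hδ0] at h2
    linarith
  set N : ℕ := ⌊X⌋₊ with hN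
  have hNle : (N : ℝ) ≤ X := Nat.floor_le (by positivity)
  have hNge : X - 1 < N := by linarith [Nat.lt_floor_add_one X]
  have hMabs := le_abs_self M
  have hMnn := abs_nonneg M
  have hNφ : φ 1 ≤ (N : ℝ) := by linarith
  have hNpos : (0 : ℝ) < N := by linarith
  refine ⟨N, by linarith, hNφ, 0, fun i => δ / max 1 |ξ i.castSucc|, ?_, ?_⟩
  · intro i
    have := hfac i
    refine ⟨by positivity, lt_of_le_of_lt (div_le_self hδ0.le this) hδ1⟩
  have hLH : L N ≤ H := by
    by_contra hlt
    push Not at hlt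
    have h1 := hLdef N hNφ
    have h2 := hφmono H (L N) hH1 hlt.le
    have h3 : X ≤ H * φ H := by
      have : 0 ≤ H * φ H := by positivity
      rw [hX]; nlinarith
    nlinarith
  have hφL : φ (L N) ≤ φ H := hφmono _ _ (hLmap N hNφ) hLH
  set r : Fin (d + 1) → ℝ := Fin.snoc (α := fun _ => ℝ) (fun i => δ / max 1 |ξ i.castSucc|) (N : ℝ)
    with hr
  have hrl : r (Fin.last d) = N := by simp [hr]
  have hrc : ∀ i : Fin d, r i.castSucc = δ / max 1 |ξ i.castSucc| := fun i => by simp [hr]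
  have hrpos : ∀ i, 0 < r i := by
    intro i
    refine Fin.lastCases ?_ (fun j => ?_) i
    · rw [hrl]; exact hNpos
    · rw [hrc]; have := hfac j; positivity
  have hrξ : ∀ i, |r i * ξ i| ≤ δ := by
    intro i
    refine Fin.lastCases ?_ (fun j => ?_) i
    · rw [hrl, abs_mul, abs_of_pos hNpos]
      have h1 : (N : ℝ) * |ξ (Fin.last d)| ≤ X * |ξ (Fin.last d)| :=
        mul_le_mul_of_nonneg_right hNle (abs_nonneg _)
      rw [hX] at h1
      nlinarith
    · have h0 := hfac j
      rw [hrc, abs_mul, abs_of_pos (by positivity), div_mul_eq_mul_div, div_le_iff₀ (by positivity)]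
      exact mul_le_mul_of_nonneg_left (le_max_right _ _) hδ0.le
  have hmain := aux_lattice w hw A hdet r hrpos a ha0
  have hprodr : ∏ i, r i = (∏ i : Fin d, δ / max 1 |ξ i.castSucc|) * N := by
    rw [Fin.prod_univ_castSucc, hrl]
    simp_rw [hrc]
  have hprodr2 : ∏ i, r i = δ ^ d / H * N := by
    rw [hprodr, Finset.prod_div_distrib]
    simp [hH, Hmul]
  have hlow : (∏ i, r i) * (smoothC w / 2 ^ (d + 1)) ≤
      ∏ i, (r i * (fhat (w i) (r i * dualPt A a i)).re) := by
    have : (∏ i, r i) * (smoothC w / 2 ^ (d + 1)) = ∏ i, (r i * ((fhat (w i) 0).re / 2)) := by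
      rw [Finset.prod_mul_distrib, Finset.prod_div_distrib]
      simp [smoothC]
    rw [this]
    refine Finset.prod_le_prod (fun i _ => ?_) (fun i _ => ?_)
    · have := (hw i).2.2.2.2
      have := hrpos i
      positivity
    · exact mul_le_mul_of_nonneg_left (hδ i _ (hrξ i)) (hrpos i).le
  have hD : (∏ i, r i) * (smoothC w / 2 ^ (d + 1)) ≤
      DboxLat d A w 0 (fun i => δ / max 1 |ξ i.castSucc|) N := by
    unfold DboxLat
    have hs : (∑' a : Fin (d+1) → ℤ, w (Fin.last d) (latPt A a (Fin.last d) / N) *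
        ∏ i : Fin d, w i.castSucc ((latPt A a i.castSucc - (0 : Fin d → ℝ) i) /
          (δ / max 1 |ξ i.castSucc|))) = ∑' a : Fin (d+1) → ℤ, ∏ i, w i (latPt A a i / r i) := by
      refine tsum_congr fun b => ?_
      rw [Fin.prod_univ_castSucc, hrl, mul_comm]
      simp_rw [hrc, Pi.zero_apply, sub_zero]
    rw [hs, ← hprodr]
    have : ∏ i, (r i * (fhat (w i) 0).re) = smoothC w * ∏ i, r i := by
      rw [Finset.prod_mul_distrib, mul_comm]; rfl
    rw [this] at hmain
    linarith
  refine le_trans ?_ (hD.trans (le_abs_self _))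
  rw [hprodr2]
  have hNX : δ / 2 * φ H ≤ N / H := by
    rw [le_div_iff₀ (by linarith)]
    have : X = δ * φ H * H := by rw [hX]; ring
    nlinarith
  calc smoothC w / 2 ^ (d + 1) * δ ^ d * (δ / 2) * φ (L N)
      ≤ smoothC w / 2 ^ (d + 1) * δ ^ d * (δ / 2) * φ H :=
        mul_le_mul_of_nonneg_left hφL (by positivity)
    _ = smoothC w / 2 ^ (d + 1) * δ ^ d * (δ / 2 * φ H) := by ring
    _ ≤ smoothC w / 2 ^ (d + 1) * δ ^ d * (N / H) :=
        mul_le_mul_of_nonneg_left hNX (by positivity)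
    _ = δ ^ d / H * N * (smoothC w / 2 ^ (d + 1)) := by ring
end

section
/- Let d ≥ 1 and k = d+1. Let φ : [1,∞) → [1,∞) be non-decreasing, let L : [φ(1),∞) → [1,∞) satisfy L(x)·φ(L(x)) = x for all x ≥ φ(1), and let Λ = Aℤ^k be a unimodular lattice in ℝ^k such that every nonzero (λ,λ_k) ∈ Λ* = (A^{−1})ᵀℤ^k (with λ ∈ ℝ^d) satisfies H(λ)·|λ_k| > 1/φ(H(λ)). Let ρ ∈ (0,1/2)^d and let N ≥ φ(1) be a real number with 2^k·ρ₁⋯ρ_d·N ≥ φ(L(N)). Then the number of points (λ,λ_k) ∈ Λ with |λᵢ| ≤ ρᵢ for all i ≤ d and |λ_k| ≤ N is at most C_k·2^k·ρ₁⋯ρ_d·N, where C_k is a constant depending only on k. -/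
open scoped BigOperators

section BohrHelpers
open MeasureTheory

/-- The half-open unit cube. -/
def bohrCube (k : ℕ) : Set (Fin k → ℝ) := Set.pi Set.univ fun _ => Set.Ico (0 : ℝ) 1

/-- The character `e(a·t)`. -/
noncomputable def bohrChar {k : ℕ} (a : Fin k → ℤ) (t : Fin k → ℝ) : ℂ :=
  ∏ i, Complex.exp (2 * Real.pi * Complex.I * (a i : ℂ) * (t i : ℂ))

lemma bohrChar_continuous {k : ℕ} (a : Fin k → ℤ) : Continuous (bohrChar a) := by
  unfold bohrChar
  fun_prop

lemma bohr_one_dim (n : ℤ) :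
    ∫ x in Set.Ico (0 : ℝ) 1, Complex.exp (2 * Real.pi * Complex.I * (n : ℂ) * (x : ℂ)) =
      if n = 0 then 1 else 0 := by
  rw [integral_Ico_eq_integral_Ioo, ← integral_Ioc_eq_integral_Ioo,
    ← intervalIntegral.integral_of_le zero_le_one]
  split_ifs with h
  · simp [h]
  · have hc : (2 * Real.pi * Complex.I * (n : ℂ)) ≠ 0 := by
      simp [Real.pi_ne_zero, h]
    rw [integral_exp_mul_complex hc]
    have : Complex.exp (2 * Real.pi * Complex.I * (n : ℂ)) = 1 := by
      rw [mul_comm]; exact Complex.exp_int_mul_two_pi_mul_I n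
    simp [this]

lemma bohr_ortho {k : ℕ} (a : Fin k → ℤ) :
    ∫ t in bohrCube k, bohrChar a t = if a = 0 then 1 else 0 := by
  unfold bohrCube bohrChar
  rw [volume_pi, Measure.restrict_pi_pi,
    integral_fintype_prod_eq_prod (fun i (x : ℝ) =>
      Complex.exp (2 * Real.pi * Complex.I * (a i : ℂ) * (x : ℂ)))]
  simp only [bohr_one_dim]
  split_ifs with h
  · simp [h]
  · obtain ⟨i, hi⟩ := Function.ne_iff.1 h
    exact Finset.prod_eq_zero (Finset.mem_univ i) (by simpa using hi)

lemma bohrChar_mul_conj {k : ℕ} (a b : Fin k → ℤ) (t : Fin k → ℝ) :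
    bohrChar a t * (starRingEnd ℂ) (bohrChar b t) = bohrChar (a - b) t := by
  unfold bohrChar
  rw [map_prod, ← Finset.prod_mul_distrib]
  refine Finset.prod_congr rfl fun i _ => ?_
  rw [← Complex.exp_conj, ← Complex.exp_add]
  congr 1
  have h2 : (starRingEnd ℂ) 2 = 2 := Complex.conj_ofNat 2
  simp [h2]
  ring

lemma bohrCube_finite (k : ℕ) : volume (bohrCube k) ≠ ⊤ := by
  unfold bohrCube
  rw [volume_pi, Measure.pi_pi]
  simp

lemma bohr_l2 {k : ℕ} (S : Finset (Fin k → ℤ)) :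
    ∫⁻ t in bohrCube k, ENNReal.ofReal (‖∑ a ∈ S, bohrChar a t‖ ^ 2) = (S.card : ENNReal) := by
  have hsub : bohrCube k ⊆ Set.Icc 0 1 := by
    intro t ht
    exact ⟨fun i => (ht i trivial).1, fun i => (ht i trivial).2.le⟩
  have hint : ∀ g : (Fin k → ℝ) → ℝ, Continuous g → IntegrableOn g (bohrCube k) := fun g hg =>
    (hg.continuousOn.integrableOn_compact isCompact_Icc).mono_set hsub
  have hintc : ∀ g : (Fin k → ℝ) → ℂ, Continuous g → IntegrableOn g (bohrCube k) := fun g hg =>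
    (hg.continuousOn.integrableOn_compact isCompact_Icc).mono_set hsub
  have hcont : Continuous fun t => ∑ a ∈ S, bohrChar (k := k) a t :=
    continuous_finsetSum _ fun a _ => bohrChar_continuous a
  rw [← ofReal_integral_eq_lintegral_ofReal (hint (fun t => ‖∑ a ∈ S, bohrChar a t‖ ^ 2) (hcont.norm.pow 2))
    (Filter.Eventually.of_forall fun t => by positivity)]
  have : ((∫ t in bohrCube k, ‖∑ a ∈ S, bohrChar a t‖ ^ 2 : ℝ) : ℂ) = (S.card : ℂ) := by
    rw [← integral_complex_ofReal]
    have : ∀ t : Fin k → ℝ, ((‖∑ a ∈ S, bohrChar a t‖ ^ 2 : ℝ) : ℂ) =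
        ∑ a ∈ S, ∑ b ∈ S, bohrChar (a - b) t := by
      intro t
      push_cast
      rw [← Complex.mul_conj', map_sum, Finset.sum_mul_sum]
      simp only [bohrChar_mul_conj]
    simp only [this]
    rw [integral_finsetSum _ fun a _ => hintc _
      (continuous_finsetSum _ fun b _ => bohrChar_continuous _)]
    have h2 : ∀ a ∈ S, ∫ t in bohrCube k, ∑ b ∈ S, bohrChar (a - b) t = 1 := by
      intro a ha
      rw [integral_finsetSum _ fun b _ => hintc _ (bohrChar_continuous _)]
      simp only [bohr_ortho, sub_eq_zero]
      simp [ha]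
    rw [Finset.sum_congr rfl h2]
    simp
  have h3 : (∫ t in bohrCube k, ‖∑ a ∈ S, bohrChar a t‖ ^ 2 : ℝ) = (S.card : ℝ) := by
    exact_mod_cast this
  rw [h3]
  simp

lemma bohrChar_periodic {k : ℕ} (a n : Fin k → ℤ) (t : Fin k → ℝ) :
    bohrChar a ((fun i => (n i : ℝ)) + t) = bohrChar a t := by
  unfold bohrChar
  refine Finset.prod_congr rfl fun i _ => ?_
  rw [Complex.exp_eq_exp_iff_exists_int]
  refine ⟨a i * n i, ?_⟩
  simp
  ring

lemma bohr_packing {k : ℕ} (E : Set (Fin k → ℝ)) (hE : MeasurableSet E)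
    (hpack : ∀ n : Fin k → ℤ, ∀ x ∈ E, (fun i => (n i : ℝ)) + x ∈ E → n = 0)
    (f : (Fin k → ℝ) → ENNReal)
    (hf : ∀ (n : Fin k → ℤ) x, f ((fun i => (n i : ℝ)) + x) = f x) :
    ∫⁻ x in E, f x ≤ ∫⁻ x in bohrCube k, f x := by
  have hF := ZSpan.isAddFundamentalDomain' (Pi.basisFun ℝ (Fin k)) volume
  rw [ZSpan.fundamentalDomain_pi_basisFun] at hF
  change IsAddFundamentalDomain _ (bohrCube k) volume at hF
  have hmemZ : ∀ g : (Submodule.span ℤ (Set.range (Pi.basisFun ℝ (Fin k)))).toAddSubgroup,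
      ∃ n : Fin k → ℤ, (g : Fin k → ℝ) = fun i => (n i : ℝ) := by
    rintro ⟨g, hg⟩
    have hg' : g ∈ Submodule.span ℤ (Set.range (Pi.basisFun ℝ (Fin k))) := hg
    rw [Module.Basis.mem_span_iff_repr_mem] at hg'
    choose n hn using hg'
    exact ⟨n, funext fun i => by simpa using (hn i).symm⟩
  have hcube : MeasurableSet (bohrCube k) :=
    MeasurableSet.univ_pi fun _ => measurableSet_Ico
  have : Countable (Submodule.span ℤ (Set.range (Pi.basisFun ℝ (Fin k)))).toAddSubgroup :=
    inferInstanceAs (Countable (Submodule.span ℤ (Set.range (Pi.basisFun ℝ (Fin k)))))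
  rw [hF.setLIntegral_eq_tsum' f E]
  have h1 : ∀ (g : (Submodule.span ℤ (Set.range (Pi.basisFun ℝ (Fin k)))).toAddSubgroup)
      (x : Fin k → ℝ), f (-g +ᵥ x) = f x := by
    intro g x
    obtain ⟨n, hn⟩ := hmemZ (-g)
    have : (-g +ᵥ x) = (fun i => (n i : ℝ)) + x := by rw [← hn]; rfl
    rw [this, hf]
  simp only [h1]
  rw [← lintegral_iUnion]
  · exact lintegral_mono_set (Set.iUnion_subset fun g => Set.inter_subset_right)
  · intro g
    exact (hE.const_vadd g).inter hcube
  · intro g h hgh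
    refine Set.disjoint_left.2 ?_
    rintro x ⟨⟨y, hy, rfl⟩, -⟩ ⟨⟨z, hz, hzy⟩, -⟩
    obtain ⟨n, hn⟩ := hmemZ (g - h)
    have hzy' : (h : Fin k → ℝ) + z = g + y := hzy
    have hz' : (fun i => (n i : ℝ)) + y = z := by
      rw [← hn, AddSubgroup.coe_sub, sub_add_eq_add_sub, ← hzy']; abel
    have h0 := hpack n y hy (hz' ▸ hz)
    apply hgh
    rw [← sub_eq_zero]
    apply Subtype.ext
    rw [hn, h0]
    ext; simp

lemma bohr_core {k : ℕ} (E : Set (Fin k → ℝ)) (hE : MeasurableSet E)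
    (hpack : ∀ n : Fin k → ℤ, ∀ x ∈ E, (fun i => (n i : ℝ)) + x ∈ E → n = 0)
    (S : Finset (Fin k → ℤ))
    (hS : ∀ a ∈ S, ∀ t ∈ E, 1 / 2 ≤ (bohrChar a t).re) :
    ENNReal.ofReal ((S.card / 2 : ℝ) ^ 2) * volume E ≤ (S.card : ENNReal) := by
  rw [← bohr_l2 S]
  refine le_trans ?_ (bohr_packing E hE hpack _ ?_)
  · rw [← setLIntegral_const]
    refine setLIntegral_mono' hE fun t ht => ?_
    apply ENNReal.ofReal_le_ofReal
    have h1 : (S.card / 2 : ℝ) ≤ (∑ a ∈ S, bohrChar a t).re := by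
      rw [Complex.re_sum]
      have := Finset.card_nsmul_le_sum S (fun a => (bohrChar a t).re) (1/2) fun a ha => hS a ha t ht
      rw [nsmul_eq_mul] at this
      linarith
    have h2 := Complex.re_le_norm (∑ a ∈ S, bohrChar a t)
    gcongr
    linarith
  · intro n x
    simp only [bohrChar_periodic]

lemma bohrChar_re {k : ℕ} (a : Fin k → ℤ) (t : Fin k → ℝ)
    (h : |∑ i, (a i : ℝ) * t i| ≤ 1 / 8) : 1 / 2 ≤ (bohrChar a t).re := by
  have : bohrChar a t = Complex.exp (((2 * Real.pi * ∑ i, (a i : ℝ) * t i : ℝ) : ℂ) * Complex.I) := by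
    unfold bohrChar
    rw [← Complex.exp_sum]
    congr 1
    push_cast
    rw [Finset.mul_sum, Finset.sum_mul]
    refine Finset.sum_congr rfl fun i _ => by ring
  rw [this, Complex.exp_ofReal_mul_I_re]
  set s := ∑ i, (a i : ℝ) * t i
  have h1 := Real.one_sub_sq_div_two_le_cos (x := 2 * Real.pi * s)
  have h2 : (2 * Real.pi * s) ^ 2 ≤ 1 := by
    rw [sq_le_one_iff_abs_le_one, abs_mul, abs_of_pos (by positivity : 0 < 2 * Real.pi)]
    nlinarith [Real.pi_lt_four, Real.pi_pos, abs_nonneg s]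
  linarith

/-- Transference: no short dual vectors implies a volume bound for points in the box. -/
lemma bohr_transfer {k : ℕ} (hk : 1 ≤ k) (A : Matrix (Fin k) (Fin k) ℝ) (hA : |A.det| = 1)
    (b : Fin k → ℝ) (hb : ∀ i, 0 < b i)
    (hdual : ∀ n : Fin k → ℤ, (∀ i, |dualPt A n i| ≤ 1 / (4 * b i)) → n = 0)
    (S : Finset (Fin k → ℤ)) (hS : ∀ a ∈ S, ∀ i, |latPt A a i| ≤ b i) :
    (S.card : ℝ) ≤ 4 * (2 * k : ℝ) ^ k * (2 ^ k * ∏ i, b i) := by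
  have hk0 : (1 : ℝ) ≤ k := by exact_mod_cast hk
  have hdet : IsUnit A.det := by
    rw [isUnit_iff_ne_zero]; intro h; simp [h] at hA
  set Q : Set (Fin k → ℝ) := Set.pi Set.univ fun i => Set.Icc (-(1 / (8 * k * b i))) (1 / (8 * k * b i))
    with hQ
  set M : (Fin k → ℝ) →ₗ[ℝ] (Fin k → ℝ) := Matrix.toLin' (A⁻¹).transpose with hM
  have hMdet : |LinearMap.det M| = 1 := by
    rw [hM, LinearMap.det_toLin', Matrix.det_transpose, Matrix.det_nonsing_inv, Ring.inverse_eq_inv',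
      abs_inv, hA, inv_one]
  have hMapp : ∀ t, M t = (A⁻¹).transpose.mulVec t := fun t => by simp [hM]
  have hQm : MeasurableSet Q := MeasurableSet.univ_pi fun _ => measurableSet_Icc
  have hMc : Continuous M := LinearMap.continuous_of_finiteDimensional M
  have hE : MeasurableSet (M ⁻¹' Q) := hMc.measurable hQm
  have hQmem : ∀ x, x ∈ Q ↔ ∀ i, |x i| ≤ 1 / (8 * k * b i) := by
    intro x; simp only [hQ, abs_le, Set.mem_pi, Set.mem_univ, Set.mem_Icc, true_imp_iff]
  have hvol : volume (M ⁻¹' Q) = ENNReal.ofReal (∏ i, 1 / (4 * k * b i)) := by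
    rw [Measure.addHaar_preimage_linearMap _ (by intro h; simp [h] at hMdet), abs_inv, hMdet, hQ,
      volume_pi, Measure.pi_pi, ENNReal.ofReal_prod_of_nonneg]
    · simp only [inv_one, ENNReal.ofReal_one, one_mul, Real.volume_Icc]
      refine Finset.prod_congr rfl fun i _ => ?_
      congr 1
      have := (hb i).ne'
      field_simp
      ring
    · intro i _
      have := hb i
      positivity
  have hcore := bohr_core (M ⁻¹' Q) hE ?_ S ?_
  · rw [hvol, ← ENNReal.ofReal_mul (by positivity), ← ENNReal.ofReal_natCast S.card,
      ENNReal.ofReal_le_ofReal_iff (by positivity)] at hcore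
    have hp : ∏ i, 1 / (4 * k * b i) = 1 / ((2 * k : ℝ) ^ k * (2 ^ k * ∏ i, b i)) := by
      rw [Finset.prod_div_distrib, Finset.prod_const_one, Finset.prod_mul_distrib]
      simp only [Finset.prod_const, Finset.card_univ, Fintype.card_fin]
      rw [← mul_assoc, ← mul_pow]
      ring_nf
    rw [hp] at hcore
    have hP : 0 < (2 * k : ℝ) ^ k * (2 ^ k * ∏ i, b i) := by
      have : 0 < ∏ i, b i := Finset.prod_pos fun i _ => hb i
      positivity
    rw [mul_one_div, div_le_iff₀ hP] at hcore
    rcases S.card.eq_zero_or_pos with h0 | h0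
    · rw [h0, mul_assoc]; push_cast; positivity
    · have h0' : (0 : ℝ) < S.card := by exact_mod_cast h0
      nlinarith
  · intro n x hx hnx
    apply hdual
    intro i
    have h1 := (hQmem _).1 hx i
    have h2 := (hQmem _).1 hnx i
    have h3 : dualPt A n i = M ((fun i => (n i : ℝ)) + x) i - M x i := by
      rw [map_add, hMapp (fun i => (n i : ℝ))]
      simp [dualPt]
    rw [h3]
    refine (abs_sub _ _).trans ?_
    have h4 : 1 / (8 * k * b i) ≤ 1 / (8 * b i) := by
      have := hb i
      apply one_div_le_one_div_of_le (by positivity)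
      nlinarith
    have h5 : 1 / (4 * b i) = 1 / (8 * b i) + 1 / (8 * b i) := by
      have := (hb i).ne'
      field_simp
      norm_num
    linarith
  · intro a ha t ht
    apply bohrChar_re
    have h1 : ∑ i, (a i : ℝ) * t i = ∑ i, latPt A a i * M t i := by
      change (fun i => (a i : ℝ)) ⬝ᵥ t = latPt A a ⬝ᵥ M t
      rw [hMapp, latPt, Matrix.dotProduct_mulVec, Matrix.vecMul_transpose, Matrix.mulVec_mulVec,
        Matrix.nonsing_inv_mul _ hdet, Matrix.one_mulVec]
    rw [h1]
    refine (Finset.abs_sum_le_sum_abs _ _).trans ?_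
    have h2 : ∀ i ∈ Finset.univ, |latPt A a i * M t i| ≤ 1 / (8 * k) := by
      intro i _
      rw [abs_mul]
      have := hb i
      calc |latPt A a i| * |M t i| ≤ b i * (1 / (8 * k * b i)) := by
            gcongr
            · exact hS a ha i
            · exact (hQmem _).1 ht i
        _ = 1 / (8 * k) := by field_simp
    refine (Finset.sum_le_sum h2).trans ?_
    simp
    field_simp
    norm_num

lemma bohr_prod_max {d : ℕ} (ρ : Fin d → ℝ) (hρ : IsBox ρ) (X : ℝ) (hX : 1 ≤ X)
    (h : ∏ i, 1 / (2 * ρ i) ≤ 2 * X) : ∏ i, max 1 (1 / (4 * ρ i)) ≤ X := by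
  have hle : ∀ i, max 1 (1 / (4 * ρ i)) ≤ 1 / (2 * ρ i) := by
    intro i
    obtain ⟨h1, h2⟩ := hρ i
    apply max_le
    · rw [le_div_iff₀ (by positivity)]; linarith
    · apply one_div_le_one_div_of_le (by positivity); linarith
  by_cases hex : ∃ j, ρ j < 1 / 4
  · obtain ⟨j, hj⟩ := hex
    have hjp := (hρ j).1
    have hj' : max 1 (1 / (4 * ρ j)) = 1 / 2 * (1 / (2 * ρ j)) := by
      rw [max_eq_right]
      · field_simp; norm_num
      · rw [le_div_iff₀ (by positivity)]; linarith
    rw [← Finset.mul_prod_erase _ _ (Finset.mem_univ j)] at h ⊢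
    have h2 : ∏ i ∈ Finset.univ.erase j, max 1 (1 / (4 * ρ i)) ≤
        ∏ i ∈ Finset.univ.erase j, 1 / (2 * ρ i) :=
      Finset.prod_le_prod (fun i _ => by positivity) fun i _ => hle i
    rw [hj']
    have h3 : 0 < 1 / (2 * ρ j) := by positivity
    nlinarith
  · push Not at hex
    rw [Finset.prod_eq_one]
    · exact hX
    · intro i _
      apply max_eq_left
      have := (hρ i).1
      rw [div_le_iff₀ (by positivity)]
      linarith [hex i]

end BohrHelpers

/-- Lemma: homogeneous Bohr set size bound. -/
theorem homogeneous_bohr_set_bound (d : ℕ) (hd : 1 ≤ d) :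
    ∃ C : ℝ, 0 < C ∧
      ∀ (φ L : ℝ → ℝ) (A : Matrix (Fin (d+1)) (Fin (d+1)) ℝ) (ρ : Fin d → ℝ) (N : ℝ),
        (∀ x, 1 ≤ x → 1 ≤ φ x) →
        (∀ x y, 1 ≤ x → x ≤ y → φ x ≤ φ y) →
        (∀ x, φ 1 ≤ x → 1 ≤ L x) →
        (∀ x, φ 1 ≤ x → L x * φ (L x) = x) →
        |A.det| = 1 →
        DualBad d A φ →
        IsBox ρ →
        φ 1 ≤ N →
        φ (L N) ≤ 2 ^ (d+1) * (∏ i, ρ i) * N →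
        {v : Fin (d+1) → ℝ | (∃ a : Fin (d+1) → ℤ, v = latPt A a) ∧
            (∀ i : Fin d, |v i.castSucc| ≤ ρ i) ∧ |v (Fin.last d)| ≤ N}.Finite ∧
        (Nat.card {v : Fin (d+1) → ℝ | (∃ a : Fin (d+1) → ℤ, v = latPt A a) ∧
            (∀ i : Fin d, |v i.castSucc| ≤ ρ i) ∧ |v (Fin.last d)| ≤ N} : ℝ) ≤
          C * (2 ^ (d+1) * (∏ i, ρ i) * N) := by
  have main : ∀ (φ L : ℝ → ℝ) (A : Matrix (Fin (d+1)) (Fin (d+1)) ℝ) (ρ : Fin d → ℝ) (N : ℝ),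
        (∀ x, 1 ≤ x → 1 ≤ φ x) →
        (∀ x y, 1 ≤ x → x ≤ y → φ x ≤ φ y) →
        (∀ x, φ 1 ≤ x → 1 ≤ L x) →
        (∀ x, φ 1 ≤ x → L x * φ (L x) = x) →
        |A.det| = 1 →
        DualBad d A φ →
        IsBox ρ →
        φ 1 ≤ N →
        φ (L N) ≤ 2 ^ (d+1) * (∏ i, ρ i) * N →
        ∀ S : Finset (Fin (d+1) → ℤ), (∀ a ∈ S, (∀ i : Fin d, |latPt A a i.castSucc| ≤ ρ i) ∧
          |latPt A a (Fin.last d)| ≤ N) →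
        (S.card : ℝ) ≤ 4 * (2 * (d + 1 : ℕ) : ℝ) ^ (d+1) * (2 ^ (d+1) * (∏ i, ρ i) * N) := by
    intro φ L A ρ N hφ1 hφm hL1 hL hA hbad hρ hN hV S hS
    have hN1 : 1 ≤ N := (hφ1 1 le_rfl).trans hN
    have hN0 : 0 < N := by linarith
    have hLN := hL1 N hN
    have hLN' := hL N hN
    have hφL := hφ1 _ hLN
    have hdet : IsUnit A.det := by
      rw [isUnit_iff_ne_zero]; intro h; simp [h] at hA
    have key := bohr_transfer (k := d + 1) (by omega) A hA (Fin.snoc (α := fun _ => ℝ) ρ N) ?_ ?_ S ?_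
    · rw [Fin.prod_univ_castSucc] at key
      simp only [Fin.snoc_castSucc, Fin.snoc_last] at key
      rw [mul_assoc (2 ^ (d + 1))]
      exact key
    · intro i
      induction i using Fin.lastCases with
      | last => simpa using hN0
      | cast i => simpa using (hρ i).1
    · intro n hn
      by_contra hn0
      have hne : dualPt A n ≠ 0 := by
        intro h
        apply hn0
        have hu : IsUnit (A⁻¹).transpose.det := by
          rw [Matrix.det_transpose, Matrix.det_nonsing_inv]
          exact hdet.ringInverse
        have hinj := Matrix.mulVec_injective_of_isUnit ((Matrix.isUnit_iff_isUnit_det _).2 hu)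
        have h0 : (fun i => (n i : ℝ)) = 0 := by
          apply hinj
          simpa [dualPt] using h
        ext i
        simpa using congrFun h0 i
      have hb := hbad n hne
      set H := Hmul (fun i : Fin d => dualPt A n i.castSucc) with hHdef
      have hH1 : 1 ≤ H := by
        rw [hHdef, Hmul]
        exact Finset.prod_induction _ (fun x : ℝ => 1 ≤ x)
          (fun a b ha hb => one_le_mul_of_one_le_of_one_le ha hb) le_rfl
          (fun i _ => le_max_left _ _)
      have hHL : H ≤ L N := by
        refine le_trans ?_ (bohr_prod_max ρ hρ (L N) hLN ?_)
        · rw [hHdef, Hmul]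
          refine Finset.prod_le_prod (fun i _ => by positivity) fun i _ => ?_
          have := hn i.castSucc
          rw [Fin.snoc_castSucc] at this
          exact max_le_max le_rfl this
        · have hp : 0 < ∏ i, ρ i := Finset.prod_pos fun i _ => (hρ i).1
          rw [Finset.prod_div_distrib, Finset.prod_const_one, Finset.prod_mul_distrib]
          simp only [Finset.prod_const, Finset.card_univ, Fintype.card_fin]
          rw [div_le_iff₀ (by positivity)]
          have h5 : φ (L N) * 1 ≤ φ (L N) * (2 * L N * (2 ^ d * ∏ i, ρ i)) := by
            calc φ (L N) * 1 ≤ 2 ^ (d+1) * (∏ i, ρ i) * N := by simpa using hV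
              _ = 2 ^ (d+1) * (∏ i, ρ i) * (L N * φ (L N)) := by rw [hLN']
              _ = _ := by ring
          exact le_of_mul_le_mul_left h5 (by linarith)
      have hφH := hφ1 H hH1
      have hφHL := hφm H (L N) hH1 hHL
      have hl := hn (Fin.last d)
      rw [Fin.snoc_last] at hl
      have h6 : N * |dualPt A n (Fin.last d)| ≤ 1 / 4 := by
        calc N * |dualPt A n (Fin.last d)| ≤ N * (1 / (4 * N)) := by gcongr
          _ = 1 / 4 := by field_simp
      rw [gt_iff_lt, div_lt_iff₀ (by linarith)] at hb
      have h7 : H * |dualPt A n (Fin.last d)| * φ H ≤ N * |dualPt A n (Fin.last d)| := by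
        calc H * |dualPt A n (Fin.last d)| * φ H ≤ L N * |dualPt A n (Fin.last d)| * φ (L N) := by
              gcongr
          _ = (L N * φ (L N)) * |dualPt A n (Fin.last d)| := by ring
          _ = _ := by rw [hLN']
      linarith
    · intro a ha i
      induction i using Fin.lastCases with
      | last => simpa using (hS a ha).2
      | cast i => simpa using (hS a ha).1 i
  refine ⟨4 * (2 * (d + 1 : ℕ) : ℝ) ^ (d+1), by positivity, ?_⟩
  intro φ L A ρ N hφ1 hφm hL1 hL hA hbad hρ hN hV
  have hS := main φ L A ρ N hφ1 hφm hL1 hL hA hbad hρ hN hV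
  set B := {v : Fin (d+1) → ℝ | (∃ a : Fin (d+1) → ℤ, v = latPt A a) ∧
            (∀ i : Fin d, |v i.castSucc| ≤ ρ i) ∧ |v (Fin.last d)| ≤ N} with hB
  have hT : ∀ T : Finset (Fin (d+1) → ℝ), (T : Set (Fin (d+1) → ℝ)) ⊆ B →
      (T.card : ℝ) ≤ 4 * (2 * (d + 1 : ℕ) : ℝ) ^ (d+1) * (2 ^ (d+1) * (∏ i, ρ i) * N) := by
    classical
    intro T hTB
    have hex : ∀ v : Fin (d+1) → ℝ, ∃ a : Fin (d+1) → ℤ, v ∈ B → v = latPt A a := by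
      intro v
      by_cases hv : v ∈ B
      · obtain ⟨a, ha⟩ := hv.1
        exact ⟨a, fun _ => ha⟩
      · exact ⟨0, fun h => absurd h hv⟩
    choose g hg using hex
    have hinj : Set.InjOn g T := by
      intro v hv w hw hvw
      rw [hg v (hTB hv), hg w (hTB hw), hvw]
    rw [← Finset.card_image_of_injOn hinj]
    apply hS
    intro a ha
    obtain ⟨v, hv, rfl⟩ := Finset.mem_image.1 ha
    have hvB := hTB hv
    rw [← hg v hvB]
    exact hvB.2
  have hfin : B.Finite := by
    by_contra hinf
    obtain ⟨n, hn⟩ := exists_nat_gt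
      (4 * (2 * (d + 1 : ℕ) : ℝ) ^ (d+1) * (2 ^ (d+1) * (∏ i, ρ i) * N))
    obtain ⟨T, hTB, hTc⟩ := Set.Infinite.exists_subset_card_eq hinf n
    have := hT T hTB
    rw [hTc] at this
    linarith
  refine ⟨hfin, ?_⟩
  have h1 := hT hfin.toFinset (by simp)
  rw [Nat.card_coe_set_eq, Set.ncard_eq_toFinset_card B hfin]
  exact h1
end

section
/- Let d ≥ 1 and k = d+1. Let φ : [1,∞) → [1,∞) be non-decreasing, let L : [φ(1),∞) → [1,∞) satisfy L(x)·φ(L(x)) = x for all x ≥ φ(1), and let Λ = Aℤ^k be a unimodular lattice in ℝ^k such that every nonzero (λ,λ_k) ∈ Λ* = (A^{−1})ᵀℤ^k (with λ ∈ ℝ^d) satisfies H(λ)·|λ_k| > 1/φ(H(λ)). Let γ ∈ ℝ^k, ρ ∈ (0,1/2)^d, and let N be a real number with 2N ≥ φ(1) and 2^k·ρ₁⋯ρ_d·N ≥ φ(L(2N)). Then the number of points (λ₁,…,λ_k) ∈ Λ with |λᵢ − γᵢ| ≤ ρᵢ for all i ≤ d and |λ_k − γ_k| ≤ N is at most C_k·2^k·ρ₁⋯ρ_d·N,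 where C_k is a constant depending only on k. -/
open scoped BigOperators

section BohrHelpers

open MeasureTheory Set

/-- The character `t ↦ e(⟨a,t⟩)`. -/
noncomputable def chr {k : ℕ} (a : Fin k → ℤ) (t : Fin k → ℝ) : ℂ :=
  ∏ i, Complex.exp (2 * Real.pi * Complex.I * (a i : ℂ) * (t i : ℂ))

lemma chr_eq {k : ℕ} (a : Fin k → ℤ) (t : Fin k → ℝ) :
    chr a t = Complex.exp (((2 * Real.pi * ∑ i, (a i : ℝ) * t i : ℝ) : ℂ) * Complex.I) := by
  rw [chr, ← Complex.exp_sum]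
  congr 1
  push_cast
  rw [Finset.mul_sum, Finset.sum_mul]
  exact Finset.sum_congr rfl fun i _ => by ring

lemma chr_continuous {k : ℕ} (a : Fin k → ℤ) : Continuous (chr a) := by
  unfold chr; fun_prop

lemma chr_periodic {k : ℕ} (a n : Fin k → ℤ) (t : Fin k → ℝ) :
    chr a (fun i => (n i : ℝ) + t i) = chr a t := by
  unfold chr
  refine Finset.prod_congr rfl fun i _ => ?_
  have : 2 * Real.pi * Complex.I * (a i : ℂ) * (((n i : ℝ) + t i : ℝ) : ℂ)
      = 2 * Real.pi * Complex.I * (a i : ℂ) * (t i : ℂ)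
        + ((a i * n i : ℤ) : ℂ) * (2 * Real.pi * Complex.I) := by
    push_cast; ring
  rw [this, Complex.exp_add, Complex.exp_int_mul_two_pi_mul_I, mul_one]

lemma integral_char_one (n : ℤ) :
    ∫ x : ℝ in Ico (0:ℝ) 1, Complex.exp (2 * Real.pi * Complex.I * (n : ℂ) * (x : ℂ))
      = if n = 0 then 1 else 0 := by
  rw [integral_Ico_eq_integral_Ioc, ← intervalIntegral.integral_of_le zero_le_one]
  split_ifs with h
  · simp [h]
  · have hc : (2 * Real.pi * Complex.I * (n : ℂ)) ≠ 0 := by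
      simp [Real.pi_ne_zero, h]
    rw [integral_exp_mul_complex hc]
    have : Complex.exp (2 * Real.pi * Complex.I * (n : ℂ) * ((1:ℝ):ℂ)) = 1 := by
      rw [← Complex.exp_int_mul_two_pi_mul_I n]; congr 1; push_cast; ring
    rw [this]; simp

lemma chr_mul_conj {k : ℕ} (a b : Fin k → ℤ) (t : Fin k → ℝ) :
    chr a t * (starRingEnd ℂ) (chr b t) = chr (a - b) t := by
  rw [chr_eq, chr_eq, chr_eq, ← Complex.exp_conj, ← Complex.exp_add]
  congr 1
  simp only [map_mul, Complex.conj_ofReal, Complex.conj_I, Pi.sub_apply]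
  push_cast
  simp only [sub_mul, Finset.sum_sub_distrib]
  ring

lemma integral_chr {k : ℕ} (a : Fin k → ℤ) :
    ∫ t in Set.pi univ (fun _ : Fin k => Ico (0:ℝ) 1), chr a t = if a = 0 then 1 else 0 := by
  rw [volume_pi, Measure.restrict_pi_pi]
  unfold chr
  rw [integral_fintype_prod_eq_prod
    (fun i (x : ℝ) => Complex.exp (2 * Real.pi * Complex.I * (a i : ℂ) * (x : ℂ)))]
  simp_rw [integral_char_one]
  split_ifs with h
  · simp [h]
  · obtain ⟨i, hi⟩ := Function.ne_iff.mp h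
    exact Finset.prod_eq_zero (Finset.mem_univ i) (by simpa using hi)

lemma integrableOn_of_cont {k : ℕ} {E : Type*} [NormedAddCommGroup E] (g : (Fin k → ℝ) → E)
    (hg : Continuous g) :
    IntegrableOn g (Set.pi univ (fun _ : Fin k => Ico (0:ℝ) 1)) := by
  have : IsCompact (Set.pi univ (fun _ : Fin k => Icc (0:ℝ) 1)) :=
    isCompact_univ_pi fun _ => isCompact_Icc
  exact (hg.continuousOn.integrableOn_compact this).mono_set
    (Set.pi_mono fun _ _ => Ico_subset_Icc_self)

lemma parseval {k : ℕ} (S : Finset (Fin k → ℤ)) :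
    ∫ t in Set.pi univ (fun _ : Fin k => Ico (0:ℝ) 1), ‖∑ a ∈ S, chr a t‖ ^ 2 = (S.card : ℝ) := by
  have key : ∀ t, ((‖∑ a ∈ S, chr a t‖ ^ 2 : ℝ) : ℂ) = ∑ a ∈ S, ∑ b ∈ S, chr (a - b) t := by
    intro t
    push_cast
    rw [← Complex.mul_conj', map_sum, Finset.sum_mul_sum]
    simp_rw [chr_mul_conj]
  have : ((∫ t in Set.pi univ (fun _ : Fin k => Ico (0:ℝ) 1), ‖∑ a ∈ S, chr a t‖ ^ 2 : ℝ) : ℂ)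
      = (S.card : ℂ) := by
    rw [← integral_complex_ofReal]
    simp_rw [key]
    rw [integral_finsetSum _ fun a _ => integrable_finsetSum _ fun b _ =>
      integrableOn_of_cont _ (chr_continuous _)]
    simp_rw [integral_finsetSum S fun b _ =>
      integrableOn_of_cont _ (chr_continuous _)]
    simp_rw [integral_chr, sub_eq_zero]
    simp
  exact_mod_cast this

lemma fold_le {k : ℕ} (E : Set (Fin k → ℝ)) (hE : MeasurableSet E)
    (hinj : ∀ n : Fin k → ℤ, ∀ t ∈ E, ∀ t' ∈ E, (∀ i, t i - t' i = n i) → n = 0)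
    (S : Finset (Fin k → ℤ)) (m : ℝ) (hm : 0 ≤ m) (hfin : volume E ≠ ⊤)
    (hlow : ∀ t ∈ E, m ≤ ‖∑ a ∈ S, chr a t‖ ^ 2) :
    m * volume.real E ≤ S.card := by
  set F := Set.pi univ (fun _ : Fin k => Ico (0:ℝ) 1) with hF
  have hc : Continuous fun t => ‖∑ a ∈ S, chr a t‖ ^ 2 :=
    (continuous_finsetSum _ fun a _ => chr_continuous a).norm.pow 2
  have hFm : MeasurableSet F := MeasurableSet.univ_pi fun _ => measurableSet_Ico
  set G := (Submodule.span ℤ (Set.range (Pi.basisFun ℝ (Fin k)))).toAddSubgroup with hG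
  haveI hcount : Countable G :=
    inferInstanceAs (Countable (Submodule.span ℤ (Set.range (Pi.basisFun ℝ (Fin k)))))
  have hdom : IsAddFundamentalDomain G F (volume : Measure (Fin k → ℝ)) := by
    rw [hF, ← ZSpan.fundamentalDomain_pi_basisFun]
    exact ZSpan.isAddFundamentalDomain' _ _
  have hGint : ∀ g : G, ∃ n : Fin k → ℤ, ∀ i, (g : Fin k → ℝ) i = n i := by
    intro g
    have := ((Pi.basisFun ℝ (Fin k)).mem_span_iff_repr_mem ℤ (g : Fin k → ℝ)).mp g.2
    choose n hn using this
    exact ⟨n, fun i => by simpa using (hn i).symm⟩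
  have h1 : ∫⁻ t in E, ENNReal.ofReal (‖∑ a ∈ S, chr a t‖ ^ 2)
      ≤ ∫⁻ t in F, ENNReal.ofReal (‖∑ a ∈ S, chr a t‖ ^ 2) := by
    rw [hdom.setLIntegral_eq_tsum']
    have hper : ∀ g : G, ∀ t : Fin k → ℝ,
        ENNReal.ofReal (‖∑ a ∈ S, chr a (-g +ᵥ t)‖ ^ 2)
          = ENNReal.ofReal (‖∑ a ∈ S, chr a t‖ ^ 2) := by
      intro g t
      obtain ⟨n, hn⟩ := hGint (-g)
      have : -g +ᵥ t = fun i => (n i : ℝ) + t i := by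
        funext i; rw [← hn i]; rfl
      simp_rw [this, chr_periodic]
    simp_rw [hper]
    rw [← lintegral_iUnion]
    · exact lintegral_mono_set (iUnion_subset fun g => inter_subset_right)
    · intro g
      exact (hE.const_vadd g).inter hFm
    · intro g g' hgg
      refine Set.disjoint_left.mpr ?_
      rintro x ⟨⟨t, ht, rfl⟩, -⟩ ⟨⟨t', ht', h'⟩, -⟩
      apply hgg
      obtain ⟨n, hn⟩ := hGint (g' - g)
      have h0 : ∀ i, (g' : Fin k → ℝ) i + t' i = (g : Fin k → ℝ) i + t i := fun i => congrFun h' i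
      have hn' : ∀ i, (g' : Fin k → ℝ) i - (g : Fin k → ℝ) i = n i := fun i => hn i
      have := hinj n t ht t' ht' fun i => by rw [← hn' i]; linarith [h0 i]
      apply Subtype.ext
      funext i
      have := hn' i
      simp_all [sub_eq_zero]
  have h2 : ENNReal.ofReal m * volume E ≤ ∫⁻ t in E, ENNReal.ofReal (‖∑ a ∈ S, chr a t‖ ^ 2) := by
    rw [← setLIntegral_const]
    exact setLIntegral_mono' hE fun t ht => ENNReal.ofReal_le_ofReal (hlow t ht)
  have h3 : ∫⁻ t in F, ENNReal.ofReal (‖∑ a ∈ S, chr a t‖ ^ 2) = ENNReal.ofReal S.card := by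
    rw [← parseval S, ofReal_integral_eq_lintegral_ofReal (integrableOn_of_cont _ hc)]
    exact Filter.Eventually.of_forall fun t => by positivity
  have h4 := (h2.trans h1).trans_eq h3
  rw [← ENNReal.ofReal_toReal hfin, ← ENNReal.ofReal_mul hm] at h4
  exact (ENNReal.ofReal_le_ofReal_iff (by positivity)).mp h4

lemma low_bound {k : ℕ} (S : Finset (Fin k → ℤ)) (t : Fin k → ℝ) (c : ℝ)
    (h : ∀ a ∈ S, |(∑ i, (a i : ℝ) * t i) - c| ≤ 1 / 8) :
    (S.card : ℝ) ^ 2 / 2 ≤ ‖∑ a ∈ S, chr a t‖ ^ 2 := by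
  have hn : ‖∑ a ∈ S, chr a t‖
      = ‖∑ a ∈ S, Complex.exp (((2 * Real.pi * ((∑ i, (a i : ℝ) * t i) - c) : ℝ) : ℂ) * Complex.I)‖ := by
    have : ∑ a ∈ S, Complex.exp (((2 * Real.pi * ((∑ i, (a i : ℝ) * t i) - c) : ℝ) : ℂ) * Complex.I)
        = (∑ a ∈ S, chr a t) * Complex.exp (((-(2 * Real.pi * c) : ℝ) : ℂ) * Complex.I) := by
      rw [Finset.sum_mul]
      refine Finset.sum_congr rfl fun a _ => ?_
      rw [chr_eq, ← Complex.exp_add]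
      congr 1
      push_cast; ring
    rw [this, norm_mul, Complex.norm_exp_ofReal_mul_I, mul_one]
  have hre : (S.card : ℝ) * (√2 / 2) ≤ ‖∑ a ∈ S, chr a t‖ := by
    rw [hn]
    refine le_trans ?_ (Complex.re_le_norm _)
    rw [Complex.re_sum, ← nsmul_eq_mul]
    refine Finset.card_nsmul_le_sum _ _ _ fun a ha => ?_
    rw [Complex.exp_ofReal_mul_I_re, ← Real.cos_pi_div_four, ← Real.cos_abs (2 * Real.pi * _)]
    have hp := Real.pi_pos
    refine Real.cos_le_cos_of_nonneg_of_le_pi (abs_nonneg _) (by linarith) ?_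
    rw [abs_mul, abs_of_pos (by positivity : 0 < 2 * Real.pi)]
    nlinarith [h a ha]
  calc (S.card : ℝ) ^ 2 / 2 = ((S.card : ℝ) * (√2 / 2)) ^ 2 := by
        rw [mul_pow, div_pow, Real.sq_sqrt (by norm_num)]; ring
    _ ≤ _ := by gcongr

lemma core {k : ℕ} (hk : 0 < k) (A : Matrix (Fin k) (Fin k) ℝ) (hA : |A.det| = 1)
    (r : Fin k → ℝ) (hr : ∀ i, 0 < r i)
    (h : ∀ n : Fin k → ℤ, (∀ i, |dualPt A n i| ≤ 1 / (2 * r i)) → n = 0)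
    (γ : Fin k → ℝ) (S : Finset (Fin k → ℤ))
    (hS : ∀ a ∈ S, ∀ i, |latPt A a i - γ i| ≤ r i) :
    (S.card : ℝ) ≤ 2 * (4 * k) ^ k * ∏ i, r i := by
  have hk' : (1:ℝ) ≤ k := by exact_mod_cast hk
  have hdet : IsUnit A.det := by
    rw [isUnit_iff_ne_zero]; intro h0; simp [h0] at hA
  set B : Set (Fin k → ℝ) := Set.pi univ fun i => Icc (-(1 / (8 * k * r i))) (1 / (8 * k * r i))
    with hB
  set E : Set (Fin k → ℝ) := Matrix.toLin' A.transpose '' B with hE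
  have hBc : IsCompact B := isCompact_univ_pi fun _ => isCompact_Icc
  have hEc : IsCompact E := hBc.image (LinearMap.continuous_of_finiteDimensional _)
  have hBabs : ∀ y ∈ B, ∀ i, |y i| ≤ 1 / (8 * k * r i) := fun y hy i =>
    abs_le.mpr (hy i (mem_univ i))
  have hvol : volume.real E = ∏ i, 1 / (4 * k * r i) := by
    rw [measureReal_def, hE, Measure.addHaar_image_linearMap, LinearMap.det_toLin',
      Matrix.det_transpose, hA, ENNReal.ofReal_one, one_mul, hB, volume_pi_pi,
      ENNReal.toReal_prod]
    refine Finset.prod_congr rfl fun i _ => ?_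
    have := hr i
    rw [Real.volume_Icc, ENNReal.toReal_ofReal]
    · field_simp; norm_num
    · have : 0 < 1 / (8 * k * r i) := by positivity
      linarith
  have hinj : ∀ n : Fin k → ℤ, ∀ t ∈ E, ∀ t' ∈ E, (∀ i, t i - t' i = n i) → n = 0 := by
    rintro n _ ⟨y, hy, rfl⟩ _ ⟨y', hy', rfl⟩ hn
    apply h
    have hd : dualPt A n = y - y' := by
      have : (fun i => (n i : ℝ)) = A.transpose.mulVec (y - y') := by
        funext i
        rw [← hn i, Matrix.mulVec_sub]; rfl
      rw [dualPt, this, Matrix.mulVec_mulVec, ← Matrix.transpose_mul,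
        Matrix.mul_nonsing_inv _ hdet, Matrix.transpose_one, Matrix.one_mulVec]
    intro i
    have hri := hr i
    rw [hd]
    have h1 := hBabs y hy i
    have h2 := hBabs y' hy' i
    have h3 : 1 / (8 * k * r i) ≤ 1 / (4 * r i) := by
      apply one_div_le_one_div_of_le (by positivity); nlinarith
    have h4 : 1 / (2 * r i) = 1 / (4 * r i) + 1 / (4 * r i) := by field_simp; norm_num
    have := abs_sub (y i) (y' i)
    simp only [Pi.sub_apply]
    linarith
  have hlow : ∀ t ∈ E, (S.card : ℝ) ^ 2 / 2 ≤ ‖∑ a ∈ S, chr a t‖ ^ 2 := by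
    rintro _ ⟨y, hy, rfl⟩
    refine low_bound S _ (∑ i, γ i * y i) fun a ha => ?_
    have e1 : ∑ i, (a i : ℝ) * (Matrix.toLin' A.transpose y) i = ∑ i, latPt A a i * y i := by
      change (fun i => (a i : ℝ)) ⬝ᵥ (A.transpose.mulVec y) = (A.mulVec fun i => (a i : ℝ)) ⬝ᵥ y
      rw [Matrix.mulVec_transpose, dotProduct_comm, ← Matrix.dotProduct_mulVec, dotProduct_comm]
    rw [e1, ← Finset.sum_sub_distrib]
    refine (Finset.abs_sum_le_sum_abs _ _).trans ?_
    calc ∑ i, |latPt A a i * y i - γ i * y i| ≤ ∑ i : Fin k, 1 / (8 * k : ℝ) := by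
          refine Finset.sum_le_sum fun i _ => ?_
          have hri := hr i
          rw [← sub_mul, abs_mul]
          calc _ ≤ r i * (1 / (8 * k * r i)) :=
                mul_le_mul (hS a ha i) (hBabs y hy i) (abs_nonneg _) hri.le
            _ = _ := by field_simp
      _ = 1 / 8 := by simp; field_simp
  have hfin := fold_le E hEc.measurableSet hinj S _ (by positivity) hEc.measure_lt_top.ne hlow
  have hprod : 0 < ∏ i, r i := Finset.prod_pos fun i _ => hr i
  rw [hvol] at hfin
  have hp : ∏ i, 1 / (4 * k * r i) = 1 / ((4 * k : ℝ) ^ k * ∏ i, r i) := by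
    rw [Finset.prod_div_distrib, Finset.prod_mul_distrib]; simp
  rw [hp] at hfin
  rcases Nat.eq_zero_or_pos S.card with h0 | h0
  · rw [h0]; push_cast; positivity
  · have hs : (0:ℝ) < S.card := by exact_mod_cast h0
    have hq : 0 < (4 * k : ℝ) ^ k * ∏ i, r i := by positivity
    rw [mul_one_div, div_le_iff₀ hq] at hfin
    have : (S.card : ℝ) * S.card ≤ S.card * (2 * (4 * k) ^ k * ∏ i, r i) := by nlinarith
    exact le_of_mul_le_mul_left this hs

lemma no_dual {d : ℕ} (φ L : ℝ → ℝ) (A : Matrix (Fin (d+1)) (Fin (d+1)) ℝ)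
    (ρ : Fin d → ℝ) (N : ℝ)
    (h1 : ∀ x, 1 ≤ x → 1 ≤ φ x)
    (h2 : ∀ x y, 1 ≤ x → x ≤ y → φ x ≤ φ y)
    (h3 : ∀ x, φ 1 ≤ x → 1 ≤ L x)
    (h4 : ∀ x, φ 1 ≤ x → L x * φ (L x) = x)
    (hA : |A.det| = 1) (hbad : DualBad d A φ) (hρ : IsBox ρ) (hN : φ 1 ≤ 2 * N)
    (hV : φ (L (2 * N)) ≤ 2 ^ (d+1) * (∏ i, ρ i) * N)
    (n : Fin (d+1) → ℤ) (hn : ∀ i : Fin d, |dualPt A n i.castSucc| ≤ 1 / (2 * ρ i))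
    (hn' : |dualPt A n (Fin.last d)| ≤ 1 / (2 * N)) : n = 0 := by
  have hdet : IsUnit A.det := by
    rw [isUnit_iff_ne_zero]; intro h0; simp [h0] at hA
  by_contra hne
  have hd : dualPt A n ≠ 0 := by
    intro h0
    apply hne
    have e : A.transpose.mulVec (dualPt A n) = fun i => (n i : ℝ) := by
      rw [dualPt, Matrix.mulVec_mulVec, ← Matrix.transpose_mul,
        Matrix.nonsing_inv_mul _ hdet, Matrix.transpose_one, Matrix.one_mulVec]
    rw [h0, Matrix.mulVec_zero] at e
    funext i
    have := congrFun e i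
    simpa using this.symm
  have hb := hbad n hd
  set H := Hmul (fun i : Fin d => dualPt A n i.castSucc) with hH
  have hH1 : 1 ≤ H := by
    rw [hH, Hmul]
    calc (1:ℝ) = ∏ _i : Fin d, (1:ℝ) := by simp
      _ ≤ _ := Finset.prod_le_prod (fun _ _ => zero_le_one) fun i _ => le_max_left _ _
  have hN0 : 0 < N := by linarith [h1 1 le_rfl]
  have hL1 := h3 _ hN
  have hL := h4 _ hN
  have hP : 0 < ∏ i, ρ i := Finset.prod_pos fun i _ => (hρ i).1
  have hHle : H ≤ 1 / (2 ^ d * ∏ i, ρ i) := by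
    have : H ≤ ∏ i, 1 / (2 * ρ i) := by
      refine Finset.prod_le_prod (fun i _ => by positivity) fun i _ => ?_
      refine max_le ?_ (hn i)
      have := hρ i
      rw [le_div_iff₀ (by linarith)]; linarith
    refine this.trans_eq ?_
    rw [Finset.prod_div_distrib, Finset.prod_mul_distrib]; simp
  have hφL := h1 _ hL1
  have hHL : H ≤ L (2 * N) := by
    refine hHle.trans ?_
    rw [div_le_iff₀ (by positivity)]
    have : L (2*N) * φ (L (2*N)) ≤ L (2*N) * (2 ^ (d+1) * (∏ i, ρ i) * N) := by gcongr
    rw [hL, pow_succ] at this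
    have h5 : 2 * N * 1 ≤ 2 * N * (L (2*N) * (2 ^ d * ∏ i, ρ i)) := by linarith
    exact le_of_mul_le_mul_left h5 (by linarith)
  have hφH := h1 _ hH1
  have hφ := h2 _ _ hH1 hHL
  have h6 : H * φ H ≤ 2 * N := by rw [← hL]; gcongr
  rw [gt_iff_lt, div_lt_iff₀ (by linarith)] at hb
  have h7 : H * |dualPt A n (Fin.last d)| * φ H ≤ 1 := by
    calc _ = (H * φ H) * |dualPt A n (Fin.last d)| := by ring
      _ ≤ (2 * N) * (1 / (2 * N)) := by gcongr
      _ = 1 := by field_simp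
  linarith


end BohrHelpers

/-- Remark: inhomogeneous Bohr set size bound. -/
theorem inhomogeneous_bohr_set_bound (d : ℕ) (hd : 1 ≤ d) :
    ∃ C : ℝ, 0 < C ∧
      ∀ (φ L : ℝ → ℝ) (A : Matrix (Fin (d+1)) (Fin (d+1)) ℝ)
        (γ : Fin (d+1) → ℝ) (ρ : Fin d → ℝ) (N : ℝ),
        (∀ x, 1 ≤ x → 1 ≤ φ x) →
        (∀ x y, 1 ≤ x → x ≤ y → φ x ≤ φ y) →
        (∀ x, φ 1 ≤ x → 1 ≤ L x) →
        (∀ x, φ 1 ≤ x → L x * φ (L x) = x) →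
        |A.det| = 1 →
        DualBad d A φ →
        IsBox ρ →
        φ 1 ≤ 2 * N →
        φ (L (2 * N)) ≤ 2 ^ (d+1) * (∏ i, ρ i) * N →
        {v : Fin (d+1) → ℝ | (∃ a : Fin (d+1) → ℤ, v = latPt A a) ∧
            (∀ i : Fin d, |v i.castSucc - γ i.castSucc| ≤ ρ i) ∧
            |v (Fin.last d) - γ (Fin.last d)| ≤ N}.Finite ∧
        (Nat.card {v : Fin (d+1) → ℝ | (∃ a : Fin (d+1) → ℤ, v = latPt A a) ∧
            (∀ i : Fin d, |v i.castSucc - γ i.castSucc| ≤ ρ i) ∧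
            |v (Fin.last d) - γ (Fin.last d)| ≤ N} : ℝ) ≤
          C * (2 ^ (d+1) * (∏ i, ρ i) * N) := by
  refine ⟨2 * (4 * ((d+1 : ℕ) : ℝ)) ^ (d+1), by positivity, ?_⟩
  intro φ L A γ ρ N h1 h2 h3 h4 hA hbad hρ hN hV
  have hN0 : 0 < N := by linarith [h1 1 le_rfl]
  have hP : 0 < ∏ i, ρ i := Finset.prod_pos fun i _ => (hρ i).1
  have hcore : ∀ S : Finset (Fin (d+1) → ℤ),
      (∀ a ∈ S, (∀ i : Fin d, |latPt A a i.castSucc - γ i.castSucc| ≤ ρ i) ∧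
        |latPt A a (Fin.last d) - γ (Fin.last d)| ≤ N) →
      (S.card : ℝ) ≤ 2 * (4 * ((d+1 : ℕ) : ℝ)) ^ (d+1) * (2 ^ (d+1) * (∏ i, ρ i) * N) := by
    intro S hS
    have hc := core (Nat.succ_pos d) A hA (Fin.snoc ρ N : Fin (d+1) → ℝ)
      (Fin.lastCases (by simpa using hN0) fun i => by simpa using (hρ i).1)
      (fun n hn => no_dual φ L A ρ N h1 h2 h3 h4 hA hbad hρ hN hV n
        (fun i => by simpa using hn i.castSucc) (by simpa using hn (Fin.last d)))
      γ S
      (fun a ha => Fin.lastCases (by simpa using (hS a ha).2)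
        fun i => by simpa using (hS a ha).1 i)
    rw [Fin.prod_univ_castSucc] at hc
    simp only [Fin.snoc_castSucc, Fin.snoc_last] at hc
    refine hc.trans (mul_le_mul_of_nonneg_left ?_ (by positivity))
    have : (1:ℝ) ≤ 2 ^ (d+1) := one_le_pow₀ (by norm_num)
    have h0 : 0 ≤ (∏ i, ρ i) * N := by positivity
    nlinarith
  set T : Set (Fin (d+1) → ℝ) := {v : Fin (d+1) → ℝ | (∃ a : Fin (d+1) → ℤ, v = latPt A a) ∧
            (∀ i : Fin d, |v i.castSucc - γ i.castSucc| ≤ ρ i) ∧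
            |v (Fin.last d) - γ (Fin.last d)| ≤ N} with hT
  set M : ℝ := 2 * (4 * ((d+1 : ℕ) : ℝ)) ^ (d+1) * (2 ^ (d+1) * (∏ i, ρ i) * N) with hM
  have hU : ∀ U : Finset (Fin (d+1) → ℝ), (U : Set (Fin (d+1) → ℝ)) ⊆ T → (U.card : ℝ) ≤ M := by
    intro U hUT
    classical
    have hex : ∀ v : Fin (d+1) → ℝ, ∃ a : Fin (d+1) → ℤ, v ∈ U → v = latPt A a := by
      intro v
      by_cases hv : v ∈ U
      · obtain ⟨a, ha⟩ := (hUT hv).1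
        exact ⟨a, fun _ => ha⟩
      · exact ⟨0, fun h => absurd h hv⟩
    choose f hf using hex
    have hinj : Set.InjOn f U := by
      intro v hv w hw hvw
      rw [hf v hv, hf w hw, hvw]
    rw [← Finset.card_image_of_injOn hinj]
    apply hcore
    intro a ha
    obtain ⟨v, hv, rfl⟩ := Finset.mem_image.mp ha
    rw [← hf v hv]
    exact (hUT hv).2
  have hfin : T.Finite := by
    by_contra hinf
    obtain ⟨U, hUT, hcard⟩ := Set.Infinite.exists_subset_card_eq hinf (⌊M⌋₊ + 1)
    have := hU U hUT
    rw [hcard] at this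
    push_cast at this
    linarith [Nat.lt_floor_add_one M]
  refine ⟨hfin, ?_⟩
  rw [Nat.card_coe_set_eq, Set.ncard_eq_toFinset_card T hfin]
  exact hU _ (by simp)
end

section
/- Let d ≥ 1, k = d+1, let ω ∈ 𝒢_{k,ℓ} for some ℓ ≥ 0, let φ : [1,∞) → [1,∞) be non-decreasing, let L : [φ(1),∞) → [1,∞) satisfy L(x)·φ(L(x)) = x for all x ≥ φ(1), and let Λ = Aℤ^k be a unimodular lattice in ℝ^k such that every nonzero (λ,λ_k) ∈ Λ* = (A^{−1})ᵀℤ^k (with λ ∈ ℝ^d) satisfies H(λ)·|λ_k| > 1/φ(H(λ)). Then there is a constant C > 0 (depending only on k and ω) such that for every integer N ≥ φ(1) and every test box 𝔅 = (γ;ρ) with vol(𝔅;N) ≤ φ(L(N)), one has |D_ω^Λ(𝔅;N)| ≤ C·φ(L(N)). -/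
open scoped BigOperators

open MeasureTheory in
/-- One-dimensional orthogonality of characters. -/
lemma aux_int_one (m : ℤ) :
    ∫ x : ℝ in Set.Ico (0:ℝ) 1, Complex.exp (2 * Real.pi * Complex.I * m * x) =
      if m = 0 then 1 else 0 := by
  rw [integral_Ico_eq_integral_Ioc, ← intervalIntegral.integral_of_le zero_le_one]
  split_ifs with h
  · simp [h]
  · have hc : (2 * Real.pi * Complex.I * m : ℂ) ≠ 0 := by
      simp [h, Real.pi_ne_zero]
    rw [integral_exp_mul_complex hc]
    have : Complex.exp (2 * Real.pi * Complex.I * m) = 1 := by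
      rw [mul_comm]
      exact Complex.exp_int_mul_two_pi_mul_I m
    simp [this]

/-- The exponential sum attached to a finite set of integer vectors. -/
noncomputable def auxG {k : ℕ} (S : Finset (Fin k → ℤ)) (η : Fin k → ℝ) : ℂ :=
  ∑ a ∈ S, Complex.exp (2 * Real.pi * Complex.I * ((∑ i, (a i : ℝ) * η i : ℝ) : ℂ))

lemma auxG_continuous {k : ℕ} (S : Finset (Fin k → ℤ)) : Continuous (auxG S) := by
  unfold auxG
  fun_prop

lemma auxG_periodic {k : ℕ} (S : Finset (Fin k → ℤ)) (b : Fin k → ℤ) (η : Fin k → ℝ) :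
    auxG S ((fun i => (b i : ℝ)) + η) = auxG S η := by
  unfold auxG
  refine Finset.sum_congr rfl fun a _ => ?_
  have : (2 * Real.pi * Complex.I * ((∑ i, (a i : ℝ) * ((fun i => (b i : ℝ)) + η) i : ℝ) : ℂ)) =
      2 * Real.pi * Complex.I * ((∑ i, (a i : ℝ) * η i : ℝ) : ℂ) +
      ((∑ i, a i * b i : ℤ) : ℂ) * (2 * Real.pi * Complex.I) := by
    simp only [Pi.add_apply, mul_add, Finset.sum_add_distrib]
    push_cast
    ring
  rw [this, Complex.exp_add, Complex.exp_int_mul_two_pi_mul_I, mul_one]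

open MeasureTheory in
lemma auxG_integral {k : ℕ} (S : Finset (Fin k → ℤ)) :
    ∫ η in Set.pi Set.univ (fun _ : Fin k => Set.Ico (0:ℝ) 1), ‖auxG S η‖ ^ 2 = S.card := by
  have key : ∀ η : Fin k → ℝ, ((‖auxG S η‖ ^ 2 : ℝ) : ℂ) =
      ∑ a ∈ S, ∑ b ∈ S, ∏ i, Complex.exp (2 * Real.pi * Complex.I * ((a i - b i : ℤ) : ℂ) * η i) := by
    intro η
    push_cast
    rw [← Complex.mul_conj', auxG, map_sum, Finset.sum_mul_sum]
    refine Finset.sum_congr rfl fun a _ => Finset.sum_congr rfl fun b _ => ?_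
    rw [← Complex.exp_conj, ← Complex.exp_add, ← Complex.exp_sum]
    congr 1
    simp only [map_mul, Complex.conj_ofReal, Complex.conj_I, map_ofNat]
    push_cast
    simp only [Finset.mul_sum, ← Finset.sum_add_distrib]
    refine Finset.sum_congr rfl fun i _ => ?_
    ring
  have hres : (volume : Measure (Fin k → ℝ)).restrict
      (Set.pi Set.univ (fun _ : Fin k => Set.Ico (0:ℝ) 1)) =
      Measure.pi (fun _ => (volume : Measure ℝ).restrict (Set.Ico (0:ℝ) 1)) := by
    rw [volume_pi, Measure.restrict_pi_pi]
  have hint : ∀ a b : Fin k → ℤ, Integrable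
      (fun η : Fin k → ℝ => ∏ i, Complex.exp (2 * Real.pi * Complex.I * ((a i - b i : ℤ) : ℂ) * η i))
      (Measure.pi (fun _ => (volume : Measure ℝ).restrict (Set.Ico (0:ℝ) 1))) := by
    intro a b
    rw [← hres]
    have hc : Continuous (fun η : Fin k → ℝ =>
        ∏ i, Complex.exp (2 * Real.pi * Complex.I * ((a i - b i : ℤ) : ℂ) * η i)) := by fun_prop
    refine IntegrableOn.mono_set (t := Set.Icc (0 : Fin k → ℝ) 1)
      (hc.continuousOn.integrableOn_compact isCompact_Icc) ?_
    intro x hx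
    exact ⟨fun i => (hx i trivial).1, fun i => (hx i trivial).2.le⟩
  apply Complex.ofReal_injective
  rw [← integral_complex_ofReal]
  simp only [key]
  rw [hres, integral_finsetSum _ (fun a _ => integrable_finsetSum _ fun b _ => hint a b)]
  simp only [integral_finsetSum _ (fun b _ => hint _ b)]
  have : ∀ a b : Fin k → ℤ, ∫ η : Fin k → ℝ,
      ∏ i, Complex.exp (2 * Real.pi * Complex.I * ((a i - b i : ℤ) : ℂ) * η i)
      ∂(Measure.pi (fun _ => (volume : Measure ℝ).restrict (Set.Ico (0:ℝ) 1))) =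
      if a = b then 1 else 0 := by
    intro a b
    rw [integral_fintype_prod_eq_prod
      (fun i (x : ℝ) => Complex.exp (2 * Real.pi * Complex.I * ((a i - b i : ℤ) : ℂ) * x))]
    simp only [aux_int_one]
    split_ifs with h
    · simp [h]
    · obtain ⟨i, hi⟩ := Function.ne_iff.mp h
      exact Finset.prod_eq_zero (Finset.mem_univ i) (by simp [sub_ne_zero.mpr hi])
  simp only [this]
  simp

open MeasureTheory in
/-- Integral over a set injecting into the torus is at most the integral over the torus. -/
lemma aux_packing {k : ℕ} (f : (Fin k → ℝ) → ENNReal)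
    (hf : ∀ (b : Fin k → ℤ) η, f ((fun i => (b i : ℝ)) + η) = f η)
    (E : Set (Fin k → ℝ)) (hE : MeasurableSet E)
    (hinj : ∀ x ∈ E, ∀ y ∈ E, ∀ b : Fin k → ℤ, x - y = (fun i => (b i : ℝ)) → x = y) :
    ∫⁻ x in E, f x ≤ ∫⁻ x in Set.pi Set.univ (fun _ : Fin k => Set.Ico (0:ℝ) 1), f x := by
  have fund := ZSpan.isAddFundamentalDomain' (Pi.basisFun ℝ (Fin k)) volume
  rw [ZSpan.fundamentalDomain_pi_basisFun] at fund
  have hmem : ∀ g : (Submodule.span ℤ (Set.range (Pi.basisFun ℝ (Fin k)))).toAddSubgroup,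
      ∃ b : Fin k → ℤ, (g : Fin k → ℝ) = fun i => (b i : ℝ) := by
    rintro ⟨g, hg⟩
    have hg' : g ∈ Submodule.span ℤ (Set.range (Pi.basisFun ℝ (Fin k))) := hg
    rw [Module.Basis.mem_span_iff_repr_mem] at hg'
    choose b hb using hg'
    exact ⟨b, funext fun i => by simpa using (hb i).symm⟩
  haveI : Countable (Submodule.span ℤ (Set.range (Pi.basisFun ℝ (Fin k)))).toAddSubgroup :=
    inferInstanceAs (Countable (Submodule.span ℤ (Set.range (Pi.basisFun ℝ (Fin k)))))
  have hneg : ∀ (g : (Submodule.span ℤ (Set.range (Pi.basisFun ℝ (Fin k)))).toAddSubgroup) x,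
      f (-g +ᵥ x) = f x := by
    intro g x
    obtain ⟨b, hb⟩ := hmem (-g)
    rw [AddSubgroup.vadd_def, vadd_eq_add, hb, hf]
  rw [fund.setLIntegral_eq_tsum']
  simp only [hneg]
  rw [← lintegral_iUnion₀]
  · exact lintegral_mono_set (Set.iUnion_subset fun g => Set.inter_subset_right)
  · intro g
    exact ((hE.const_vadd g).nullMeasurableSet).inter fund.nullMeasurableSet
  · intro g h hgh
    refine Disjoint.aedisjoint ?_
    rw [Set.disjoint_left]
    rintro z ⟨⟨x, hx, hxz⟩, _⟩ ⟨⟨y, hy, hyz⟩, _⟩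
    apply hgh
    simp only [AddSubgroup.vadd_def, vadd_eq_add] at hxz hyz
    obtain ⟨b, hb⟩ := hmem (h - g)
    have hxy : x - y = (h : Fin k → ℝ) - g := by
      rw [sub_eq_sub_iff_add_eq_add, add_comm, hxz, ← hyz]
    have := hinj x hx y hy b (by rw [hxy, ← hb]; rfl)
    rw [this, sub_self] at hxy
    exact Subtype.ext (sub_eq_zero.mp hxy.symm).symm

lemma aux_dot {k : ℕ} (A : Matrix (Fin k) (Fin k) ℝ) (hA : |A.det| = 1)
    (a : Fin k → ℤ) (η : Fin k → ℝ) :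
    ∑ i, latPt A a i * ((A⁻¹).transpose.mulVec η) i = ∑ i, (a i : ℝ) * η i := by
  have hu : IsUnit A.det := by
    rw [isUnit_iff_ne_zero]; intro h; simp [h] at hA
  change dotProduct (A.mulVec (fun i => (a i : ℝ))) ((A⁻¹).transpose.mulVec η) =
    dotProduct (fun i => (a i : ℝ)) η
  rw [Matrix.mulVec_transpose, dotProduct_comm, ← Matrix.dotProduct_mulVec,
    Matrix.mulVec_mulVec, Matrix.nonsing_inv_mul _ hu, Matrix.one_mulVec, dotProduct_comm]

open MeasureTheory in
/-- Main counting lemma. -/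
lemma aux_count {k : ℕ} (hk : 0 < k) (A : Matrix (Fin k) (Fin k) ℝ) (hA : |A.det| = 1)
    (r c : Fin k → ℝ) (hr : ∀ i, 0 < r i)
    (hdual : ∀ a : Fin k → ℤ, (∀ i, |dualPt A a i| ≤ 1 / r i) → dualPt A a = 0)
    (S : Finset (Fin k → ℤ)) (hS : ∀ a ∈ S, ∀ i, |latPt A a i - c i| ≤ 2 * r i) :
    (S.card : ℝ) ≤ 4 * (6 * k) ^ k * ∏ i, r i := by
  have hk' : (1:ℝ) ≤ k := by exact_mod_cast hk
  have hu : IsUnit A.det := by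
    rw [isUnit_iff_ne_zero]; intro h; simp [h] at hA
  set B := (A⁻¹).transpose with hB
  have hBdet : |B.det| = 1 := by
    rw [hB, Matrix.det_transpose, Matrix.det_nonsing_inv, Ring.inverse_eq_inv', abs_inv, hA, inv_one]
  have hBinj : Function.Injective B.mulVec := by
    apply Matrix.mulVec_injective_of_isUnit
    rw [Matrix.isUnit_iff_isUnit_det, isUnit_iff_ne_zero]
    intro h; simp [h] at hBdet
  set Q : Set (Fin k → ℝ) := Set.Icc (fun i => -(1 / (12 * k * r i))) (fun i => 1 / (12 * k * r i))
    with hQ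
  set E : Set (Fin k → ℝ) := (Matrix.toLin' B) ⁻¹' Q with hE
  have hEm : MeasurableSet E := by
    have : Continuous (Matrix.toLin' B) := LinearMap.continuous_of_finiteDimensional _
    exact this.measurable measurableSet_Icc
  have hEmem : ∀ x ∈ E, ∀ i, |B.mulVec x i| ≤ 1 / (12 * k * r i) := by
    intro x hx i
    rw [hE, Set.mem_preimage, Matrix.toLin'_apply] at hx
    exact abs_le.mpr ⟨hx.1 i, hx.2 i⟩
  have hEvol : volume E = ENNReal.ofReal (∏ i, (1 / (6 * k * r i))) := by
    rw [hE, Measure.addHaar_preimage_linearMap, LinearMap.det_toLin', abs_inv, hBdet, hQ,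
      Real.volume_Icc_pi, ENNReal.ofReal_prod_of_nonneg]
    · simp only [inv_one, ENNReal.ofReal_one, one_mul]
      refine Finset.prod_congr rfl fun i _ => ?_
      congr 1
      have := hr i
      field_simp
      norm_num
    · intro i _
      have := hr i
      positivity
    · rw [LinearMap.det_toLin']; intro h; simp [h] at hBdet
  have hinj : ∀ x ∈ E, ∀ y ∈ E, ∀ b : Fin k → ℤ, x - y = (fun i => (b i : ℝ)) → x = y := by
    intro x hx y hy b hb
    have h0 : dualPt A b = 0 := by
      apply hdual
      intro i
      have hri := hr i
      unfold dualPt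
      rw [← hB, ← hb, Matrix.mulVec_sub, Pi.sub_apply]
      calc |B.mulVec x i - B.mulVec y i| ≤ |B.mulVec x i| + |B.mulVec y i| := abs_sub _ _
        _ ≤ 1 / (12 * k * r i) + 1 / (12 * k * r i) := add_le_add (hEmem x hx i) (hEmem y hy i)
        _ ≤ 1 / r i := by
          rw [← sub_nonneg]
          have : 1 / r i - (1 / (12 * k * r i) + 1 / (12 * k * r i)) = (6 * k - 1) / (6 * k * r i) := by
            field_simp
            ring
          rw [this]
          apply div_nonneg <;> nlinarith
    have : B.mulVec (x - y) = B.mulVec 0 := by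
      rw [hb, Matrix.mulVec_zero]; exact h0
    exact sub_eq_zero.mp (hBinj this)
  have hlow : ∀ x ∈ E, (S.card : ℝ) / 2 ≤ ‖auxG S x‖ := by
    intro x hx
    set t : ℝ := ∑ i, c i * B.mulVec x i with ht
    have h1 : ‖auxG S x‖ = ‖Complex.exp ((-(2 * Real.pi * t) : ℝ) * Complex.I) * auxG S x‖ := by
      rw [norm_mul, Complex.norm_exp_ofReal_mul_I, one_mul]
    rw [h1]
    refine le_trans ?_ (Complex.re_le_norm _)
    rw [auxG, Finset.mul_sum, Complex.re_sum]
    have : (S.card : ℝ) / 2 = ∑ a ∈ S, (1/2 : ℝ) := by simp; ring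
    rw [this]
    refine Finset.sum_le_sum fun a ha => ?_
    rw [← Complex.exp_add, ← aux_dot A hA]
    have h2 : ((-(2 * Real.pi * t) : ℝ) : ℂ) * Complex.I + 2 * Real.pi * Complex.I *
        ((∑ i, latPt A a i * ((A⁻¹).transpose.mulVec x) i : ℝ) : ℂ) =
        ((2 * Real.pi * ∑ i, (latPt A a i - c i) * B.mulVec x i : ℝ) : ℂ) * Complex.I := by
      rw [ht]
      simp only [sub_mul, Finset.sum_sub_distrib]
      push_cast
      ring
    rw [h2, Complex.exp_ofReal_mul_I_re]
    have h3 : |∑ i, (latPt A a i - c i) * B.mulVec x i| ≤ 1 / 6 := by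
      calc |∑ i, (latPt A a i - c i) * B.mulVec x i|
          ≤ ∑ i, |(latPt A a i - c i) * B.mulVec x i| := Finset.abs_sum_le_sum_abs _ _
        _ ≤ ∑ i : Fin k, 1 / (6 * k : ℝ) := by
          refine Finset.sum_le_sum fun i _ => ?_
          have hri := hr i
          rw [abs_mul]
          calc _ ≤ (2 * r i) * (1 / (12 * k * r i)) :=
                mul_le_mul (hS a ha i) (hEmem x hx i) (abs_nonneg _) (by positivity)
            _ = 1 / (6 * k : ℝ) := by field_simp; norm_num
        _ = 1 / 6 := by
          simp; field_simp
    rw [← Real.cos_abs, ← Real.cos_pi_div_three]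
    apply Real.cos_le_cos_of_nonneg_of_le_pi (abs_nonneg _) (by linarith [Real.pi_pos])
    rw [abs_mul, abs_of_pos Real.two_pi_pos]
    nlinarith [Real.pi_pos]
  have hint := auxG_integral S
  have hpack := aux_packing (fun η => ENNReal.ofReal (‖auxG S η‖ ^ 2))
    (fun b η => by simp only [auxG_periodic]) E hEm hinj
  have hIon : IntegrableOn (fun η => ‖auxG S η‖ ^ 2)
      (Set.pi Set.univ (fun _ : Fin k => Set.Ico (0:ℝ) 1)) := by
    refine IntegrableOn.mono_set (t := Set.Icc (0 : Fin k → ℝ) 1)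
      ((((auxG_continuous S).norm.pow 2)).continuousOn.integrableOn_compact isCompact_Icc) ?_
    intro x hx
    exact ⟨fun i => (hx i trivial).1, fun i => (hx i trivial).2.le⟩
  rw [← ofReal_integral_eq_lintegral_ofReal hIon (Filter.Eventually.of_forall fun _ => by positivity),
    hint] at hpack
  have hlower : ENNReal.ofReal (((S.card : ℝ) / 2) ^ 2) * volume E ≤
      ∫⁻ x in E, ENNReal.ofReal (‖auxG S x‖ ^ 2) := by
    rw [← setLIntegral_const]
    refine setLIntegral_mono' hEm fun x hx => ENNReal.ofReal_le_ofReal ?_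
    have := hlow x hx
    gcongr
  have hfin := hlower.trans hpack
  rw [hEvol, ← ENNReal.ofReal_mul (by positivity), ENNReal.ofReal_le_ofReal_iff (by positivity)] at hfin
  have hP : 0 < ∏ i, r i := Finset.prod_pos fun i _ => hr i
  have hprod : ∏ i, (1 / (6 * k * r i)) = 1 / ((6 * k) ^ k * ∏ i, r i) := by
    rw [Finset.prod_div_distrib, Finset.prod_mul_distrib]
    simp
  rw [hprod] at hfin
  rcases Nat.eq_zero_or_pos S.card with h0 | h0
  · rw [h0]; push_cast; positivity
  · have h0' : (0:ℝ) < S.card := by exact_mod_cast h0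
    have hD : (0:ℝ) < (6 * k) ^ k * ∏ i, r i := by positivity
    rw [mul_one_div, div_le_iff₀ hD] at hfin
    nlinarith

/-- Enlarging the box so that it has prescribed volume. -/
lemma aux_enlarge {d : ℕ} (ρ : Fin d → ℝ) (hρ : IsBox ρ) (v : ℝ) (hv1 : v ≤ 1)
    (hv : ∏ i, ρ i ≤ v) :
    ∃ σ : Fin d → ℝ, (∀ i, ρ i ≤ σ i) ∧ (∀ i, σ i ≤ 1) ∧ ∏ i, σ i = v := by
  have hc : ContinuousOn (fun t : ℝ => ∏ i, (ρ i + t * (1 - ρ i))) (Set.Icc 0 1) := by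
    apply Continuous.continuousOn
    fun_prop
  obtain ⟨t, ht, htv⟩ := intermediate_value_Icc zero_le_one hc
    (show v ∈ _ from ⟨by simpa using hv, by simpa using hv1⟩)
  refine ⟨fun i => ρ i + t * (1 - ρ i), fun i => ?_, fun i => ?_, htv⟩
  · nlinarith [hρ i, ht.1, ht.2]
  · nlinarith [hρ i, ht.1, ht.2]

lemma aux_bdd (w : ℝ → ℝ) (hc : Continuous w) (hs : Function.support w ⊆ Set.Icc (-2 : ℝ) 2) :
    ∃ M : ℝ, ∀ x, w x ≤ M := by
  have hcs : HasCompactSupport w := HasCompactSupport.intro isCompact_Icc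
    (fun x hx => by_contra fun h => hx (hs h))
  obtain ⟨M, hM⟩ := hc.bounded_above_of_compact_support hcs
  exact ⟨M, fun x => (le_abs_self _).trans (hM x)⟩

/-- Lemma: discrepancy bound for boxes of small volume. -/
theorem smooth_lattice_discrepancy_small_boxes
    (d ℓ : ℕ) (hd : 1 ≤ d) (w : Fin (d+1) → ℝ → ℝ) (hw : GoodWeights (d+1) ℓ w) :
    ∃ C : ℝ, 0 < C ∧
      ∀ (φ L : ℝ → ℝ) (A : Matrix (Fin (d+1)) (Fin (d+1)) ℝ),
        (∀ x, 1 ≤ x → 1 ≤ φ x) →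
        (∀ x y, 1 ≤ x → x ≤ y → φ x ≤ φ y) →
        (∀ x, φ 1 ≤ x → 1 ≤ L x) →
        (∀ x, φ 1 ≤ x → L x * φ (L x) = x) →
        |A.det| = 1 →
        DualBad d A φ →
        ∀ N : ℕ, φ 1 ≤ (N : ℝ) → ∀ γ ρ : Fin d → ℝ, IsBox ρ →
          (∏ i, ρ i) * N ≤ φ (L N) →
          |DboxLat d A w γ ρ N| ≤ C * φ (L N) := by
  have hb : ∀ i, ∃ M : ℝ, ∀ x, w i x ≤ M := fun i =>
    aux_bdd (w i) (hw i).2.2.1.continuous (hw i).2.1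
  choose M hM using hb
  have hM0 : ∀ i, 0 ≤ M i := fun i => ((hw i).1 0).trans (hM i 0)
  have hsC : 0 < smoothC w := Finset.prod_pos fun i _ => (hw i).2.2.2.2
  set P : ℝ := ∏ i, M i with hPdef
  have hP0 : 0 ≤ P := Finset.prod_nonneg fun i _ => hM0 i
  set K : ℝ := 4 * (6 * ((d + 1 : ℕ) : ℝ)) ^ (d + 1) with hK
  have hK0 : 0 ≤ K := by positivity
  refine ⟨P * K + smoothC w, by positivity, ?_⟩
  intro φ L A hφ1 hφm hL1 hL hA hbad N hN γ ρ hρ hvol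
  have hT := hL1 N hN
  have hTN := hL N hN
  set T := L N with hTdef
  have hφT := hφ1 T hT
  have hN0 : (0:ℝ) < N := by rw [← hTN]; positivity
  have hρ0 : 0 < ∏ i, ρ i := Finset.prod_pos fun i _ => (hρ i).1
  have hv : ∏ i, ρ i ≤ 1 / T := by
    rw [le_div_iff₀ (by linarith)]
    rw [← hTN] at hvol
    have : ((∏ i, ρ i) * T) * φ T ≤ 1 * φ T := by linarith
    exact le_of_mul_le_mul_right this (by linarith)
  obtain ⟨σ, hρσ, hσ1, hσ⟩ := aux_enlarge ρ hρ (1 / T)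
    (by rw [div_le_one (by linarith)]; exact hT) hv
  have hσ0 : ∀ i, 0 < σ i := fun i => (hρ i).1.trans_le (hρσ i)
  set f : (Fin (d+1) → ℤ) → ℝ := fun a => w (Fin.last d) (latPt A a (Fin.last d) / N) *
        ∏ i : Fin d, w i.castSucc ((latPt A a i.castSucc - γ i) / ρ i) with hf
  have hf0 : ∀ a, 0 ≤ f a := fun a =>
    mul_nonneg ((hw _).1 _) (Finset.prod_nonneg fun i _ => (hw _).1 _)
  have hfP : ∀ a, f a ≤ P := by
    intro a
    rw [hPdef, Fin.prod_univ_castSucc, mul_comm (∏ i : Fin d, M i.castSucc)]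
    exact mul_le_mul (hM _ _) (Finset.prod_le_prod (fun i _ => (hw _).1 _) fun i _ => hM _ _)
      (Finset.prod_nonneg fun i _ => (hw _).1 _) (hM0 _)
  set r : Fin (d+1) → ℝ := Fin.snoc (α := fun _ => ℝ) σ (N : ℝ) with hrdef
  set c : Fin (d+1) → ℝ := Fin.snoc (α := fun _ => ℝ) γ (0 : ℝ) with hcdef
  have hr0 : ∀ i, 0 < r i := by
    intro i
    refine Fin.lastCases ?_ (fun j => ?_) i
    · simpa [hrdef] using hN0
    · simpa [hrdef] using hσ0 j
  have hrprod : ∏ i, r i = φ T := by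
    rw [Fin.prod_univ_castSucc]
    simp only [hrdef, Fin.snoc_castSucc, Fin.snoc_last]
    rw [hσ, ← hTN]
    field_simp
  have hdual : ∀ a : Fin (d+1) → ℤ, (∀ i, |dualPt A a i| ≤ 1 / r i) → dualPt A a = 0 := by
    intro a ha
    by_contra hne
    have hb := hbad a hne
    set H := Hmul (fun i : Fin d => dualPt A a i.castSucc) with hH
    have hH1 : 1 ≤ H := by
      rw [hH, Hmul]
      calc (1:ℝ) = ∏ _i : Fin d, (1:ℝ) := by simp
        _ ≤ _ := Finset.prod_le_prod (fun i _ => zero_le_one) fun i _ => le_max_left _ _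
    have hHT : H ≤ T := by
      have : T = ∏ i, (1 / σ i) := by
        rw [Finset.prod_div_distrib, hσ]; simp
      rw [this, hH, Hmul]
      refine Finset.prod_le_prod (fun i _ => by positivity) fun i _ => max_le ?_ ?_
      · rw [le_div_iff₀ (hσ0 i), one_mul]; exact hσ1 i
      · have := ha i.castSucc
        simpa only [hrdef, Fin.snoc_castSucc] using this
    have hφH := hφ1 H hH1
    have hφHT := hφm H T hH1 hHT
    have hlast : |dualPt A a (Fin.last d)| ≤ 1 / N := by
      have := ha (Fin.last d)
      simpa only [hrdef, Fin.snoc_last] using this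
    have h1 : 1 / φ T ≤ 1 / φ H := one_div_le_one_div_of_le (by linarith) hφHT
    have h2 : H * |dualPt A a (Fin.last d)| ≤ T * (1 / N) :=
      mul_le_mul hHT hlast (abs_nonneg _) (by linarith)
    have h3 : T * (1 / (N:ℝ)) = 1 / φ T := by
      rw [← hTN]; field_simp
    linarith
  have hsum : ∀ s : Finset (Fin (d+1) → ℤ), ∑ a ∈ s, f a ≤ P * K * φ T := by
    intro s
    have hcount := aux_count (Nat.succ_pos d) A hA r c hr0 hdual (s.filter fun a => f a ≠ 0) (by
      intro a ha i
      rw [Finset.mem_filter] at ha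
      have hne := ha.2
      have hl := left_ne_zero_of_mul hne
      have hrr := right_ne_zero_of_mul hne
      rw [Finset.prod_ne_zero_iff] at hrr
      refine Fin.lastCases ?_ (fun j => ?_) i
      · have h := (hw _).2.1 (Function.mem_support.mpr hl)
        simp only [hrdef, hcdef, Fin.snoc_last]
        rw [Set.mem_Icc, ← abs_le, abs_div, abs_of_pos hN0, div_le_iff₀ hN0] at h
        simpa using h
      · have h := (hw _).2.1 (Function.mem_support.mpr (hrr j (Finset.mem_univ _)))
        simp only [hrdef, hcdef, Fin.snoc_castSucc]
        rw [Set.mem_Icc, ← abs_le, abs_div, abs_of_pos (hρ j).1, div_le_iff₀ (hρ j).1] at h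
        linarith [hρσ j])
    rw [hrprod, ← hK] at hcount
    rw [← Finset.sum_filter_ne_zero]
    calc _ ≤ ∑ a ∈ s.filter fun a => f a ≠ 0, P := Finset.sum_le_sum fun a _ => hfP a
      _ = P * ((s.filter fun a => f a ≠ 0).card : ℝ) := by simp [mul_comm]
      _ ≤ P * (K * φ T) := by gcongr
      _ = _ := by ring
  have htle : ∑' a, f a ≤ P * K * φ T := Real.tsum_le_of_sum_le hf0 hsum
  have ht0 : 0 ≤ ∑' a, f a := tsum_nonneg hf0
  have hV : smoothC w * ((∏ i, ρ i) * N) ≤ smoothC w * φ T := by gcongr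
  have hV0 : 0 ≤ smoothC w * ((∏ i, ρ i) * N) := by positivity
  have hPK : 0 ≤ P * K * φ T := by positivity
  have hsT : 0 ≤ smoothC w * φ T := by positivity
  have : DboxLat d A w γ ρ N = (∑' a, f a) - smoothC w * ((∏ i, ρ i) * N) := rfl
  rw [this, abs_le]
  constructor <;> nlinarith
end

section
/- Let d ≥ 1, k = d+1, let Λ = Aℤ^k be a unimodular lattice in ℝ^k, and let ω ∈ 𝒢_{k,ℓ}. Suppose φ : [1,∞) → [1,∞) is non-decreasing, every nonzero (λ,λ_k) ∈ Λ* = (A^{−1})ᵀℤ^k (with λ ∈ ℝ^d) satisfies H(λ)·|λ_k| > 1/φ(H(λ)), ξ := limsup_{x→∞} φ(2x)/φ(x) < ∞, and ℓ > 2 + 2·log ξ / log 2. Let L : [φ(1),∞) → [1,∞) satisfy L(x)·φ(L(x)) = x for all x ≥ φ(1). Then there is a constant C > 0 such that for every integer N ≥ φ(1) and every test box 𝔅 = (γ;ρ) with vol(𝔅;N) > φ(L(N)), one has |D_ω^Λ(𝔅;N)| ≤ C·φ(L(N)). -/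
open scoped BigOperators

section Poisson
open MeasureTheory

theorem finite_int_box {k : ℕ} (R : ℝ) :
    {a : Fin k → ℤ | ∀ i, |(a i : ℝ)| ≤ R}.Finite := by
  apply (Set.finite_Icc (fun _ : Fin k => -⌈R⌉) (fun _ => ⌈R⌉)).subset
  intro a ha
  constructor
  · intro i
    have h1 := (abs_le.mp (ha i)).1
    have h2 := Int.le_ceil R
    have : (-⌈R⌉ : ℝ) ≤ (a i : ℝ) := by linarith
    exact_mod_cast this
  · intro i
    have h1 := (abs_le.mp (ha i)).2
    have h2 := Int.le_ceil R
    have : (a i : ℝ) ≤ (⌈R⌉ : ℝ) := by linarith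
    exact_mod_cast this

/-- integer vector as a real vector -/
def ivec {k : ℕ} (a : Fin k → ℤ) : Fin k → ℝ := fun i => (a i : ℝ)

/-- the half-open cube based at an integer vector -/
def icube {k : ℕ} (a : Fin k → ℤ) : Set (Fin k → ℝ) :=
  {x | ∀ i, x i ∈ Set.Ioc ((a i : ℝ)) ((a i : ℝ) + 1)}

theorem icube_meas {k : ℕ} (a : Fin k → ℤ) : MeasurableSet (icube a) := by
  have : icube a = Set.pi Set.univ (fun i => Set.Ioc ((a i : ℝ)) ((a i : ℝ) + 1)) := by
    ext x; simp [icube]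
  rw [this]
  exact MeasurableSet.univ_pi (fun i => measurableSet_Ioc)

theorem icube_unique {k : ℕ} {a : Fin k → ℤ} {x : Fin k → ℝ} (h : x ∈ icube a) :
    a = fun i => ⌈x i⌉ - 1 := by
  funext i
  have := h i
  have h2 : ⌈x i⌉ = a i + 1 := by
    rw [Int.ceil_eq_iff]
    push_cast
    exact ⟨by linarith [this.1], this.2⟩
  omega

theorem icube_union {k : ℕ} : (⋃ a : Fin k → ℤ, icube a) = Set.univ := by
  rw [Set.eq_univ_iff_forall]
  intro x
  rw [Set.mem_iUnion]
  refine ⟨fun i => ⌈x i⌉ - 1, fun i => ?_⟩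
  push_cast
  exact ⟨by linarith [Int.ceil_lt_add_one (x i)], by linarith [Int.le_ceil (x i)]⟩

theorem icube_disj {k : ℕ} : Pairwise (Function.onFun Disjoint (fun a : Fin k → ℤ => icube a)) := by
  intro a b hab
  rw [Function.onFun, Set.disjoint_left]
  intro x hx hx'
  exact hab ((icube_unique hx).trans (icube_unique hx').symm)

theorem integral_unfold {k : ℕ} (G : (Fin k → ℝ) → ℂ) (hG : Integrable G) :
    ∫ x, G x = ∑' a : Fin k → ℤ, ∫ x in icube (0 : Fin k → ℤ), G (x + ivec a) := by
  rw [← setIntegral_univ, ← icube_union,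
    integral_iUnion icube_meas icube_disj (by rw [icube_union]; exact hG.integrableOn)]
  congr 1
  funext a
  have h := (measurePreserving_add_right (volume : Measure (Fin k → ℝ)) (ivec a)).setIntegral_preimage_emb
    (measurableEmbedding_addRight (ivec a)) G (icube a)
  rw [← h]
  congr 2
  ext x
  simp only [icube, ivec, Set.mem_preimage, Set.mem_ofPred_eq, Pi.add_apply, Set.mem_Ioc, Pi.zero_apply, Int.cast_zero]
  refine forall_congr' fun i => ?_
  constructor <;> rintro ⟨h1, h2⟩ <;> constructor <;> linarith

theorem poisson_multi {k : ℕ} (f : (Fin k → ℝ) → ℂ) (hf : Continuous f) (R : ℝ)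
    (hR : ∀ x, f x ≠ 0 → ∀ i, |x i| ≤ R) (c : (Fin k → ℤ) → ℂ)
    (hc : ∀ n, c n = ∫ x : Fin k → ℝ,
      Complex.exp (-(2 * Real.pi * Complex.I * ∑ i, (n i : ℂ) * (x i : ℂ))) * f x)
    (hs : Summable c) : HasSum c (∑' a : Fin k → ℤ, f (ivec a)) := by
  classical
  set Ft : (Fin k → ℝ) → ℂ := fun x => ∑' a : Fin k → ℤ, f (x + ivec a) with hFt
  -- compact support
  have hbound : ∀ (M : ℝ) (x : Fin k → ℝ), (∀ i, |x i| ≤ M) → ∀ a : Fin k → ℤ,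
      f (x + ivec a) ≠ 0 → a ∈ {a : Fin k → ℤ | ∀ i, |(a i : ℝ)| ≤ R + M} := by
    intro M x hx a ha i
    have h1 := hR _ ha i
    have h2 := hx i
    simp only [Pi.add_apply, ivec] at h1
    rw [abs_le] at *
    constructor <;> linarith
  have hlf : LocallyFinite fun a : Fin k → ℤ => Function.support (fun x => f (x + ivec a)) := by
    intro x
    refine ⟨Metric.ball x 1, Metric.ball_mem_nhds x one_pos, ?_⟩
    refine (finite_int_box (k := k) (R + (‖x‖ + 1))).subset ?_
    rintro a ⟨y, hy, hyb⟩
    refine hbound (‖x‖+1) y ?_ a hy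
    intro i
    have h1 : ‖y‖ ≤ ‖x‖ + 1 := by
      have := norm_le_norm_add_norm_sub' y x
      have h3 := mem_ball_iff_norm.mp hyb
      linarith
    exact (norm_le_pi_norm y i).trans h1
  have hfin : ∀ x, (Function.support fun a : Fin k → ℤ => f (x + ivec a)).Finite := by
    intro x
    exact hlf.point_finite x
  have hFtc : Continuous Ft := by
    have := continuous_finsum (f := fun (a : Fin k → ℤ) x => f (x + ivec a)) (fun a => by fun_prop) hlf
    convert! this using 1
    funext x
    exact tsum_eq_finsum (hfin x)
  have hper : ∀ x (b : Fin k → ℤ), Ft (x + ivec b) = Ft x := by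
    intro x b
    simp only [hFt]
    rw [← (Equiv.addLeft b).tsum_eq (fun a => f (x + ivec a))]
    congr 1
    funext a
    congr 1
    funext i
    simp [ivec, add_assoc]
  -- quotient map
  let q : (Fin k → ℝ) → UnitAddTorus (Fin k) := fun x i => (x i : UnitAddCircle)
  have hq : IsOpenQuotientMap q :=
    IsOpenQuotientMap.piMap (f := fun (_ : Fin k) (x : ℝ) => (x : UnitAddCircle))
      (fun i => QuotientAddGroup.isOpenQuotientMap_mk)
  let F : UnitAddTorus (Fin k) → ℂ := fun t => Ft (Function.surjInv hq.surjective t)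
  have hFq : ∀ x, F (q x) = Ft x := by
    intro x
    have h1 : q (Function.surjInv hq.surjective (q x)) = q x := Function.surjInv_eq _ _
    set y := Function.surjInv hq.surjective (q x) with hy
    have h2 : ∀ i, ∃ b : ℤ, y i = x i + b := by
      intro i
      have h3 : ((y i : ℝ) : UnitAddCircle) = (x i : UnitAddCircle) := congrFun h1 i
      rw [← sub_eq_zero, ← AddCircle.coe_sub, AddCircle.coe_eq_zero_iff] at h3
      obtain ⟨b, hb⟩ := h3
      refine ⟨b, ?_⟩
      simp at hb
      linarith
    choose b hb using h2
    have h4 : y = x + ivec b := by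
      funext i; simp [ivec, hb i]
    show Ft y = Ft x
    rw [h4, hper]
  have hFc : Continuous F := by
    rw [← hq.continuous_comp_iff]
    have : F ∘ q = Ft := funext hFq
    rw [this]; exact hFtc
  let Fc : C(UnitAddTorus (Fin k), ℂ) := ⟨F, hFc⟩
  have hchar : ∀ (n : Fin k → ℤ) (x : Fin k → ℝ), UnitAddTorus.mFourier (-n) (q x) =
      Complex.exp (-(2 * Real.pi * Complex.I * ∑ i, (n i : ℂ) * (x i : ℂ))) := by
    intro n x
    simp only [UnitAddTorus.mFourier, ContinuousMap.coe_mk, q, fourier_coe_apply]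
    rw [← Complex.exp_sum]
    congr 1
    rw [Finset.mul_sum, ← Finset.sum_neg_distrib]
    refine Finset.sum_congr rfl fun i _ => ?_
    simp
    ring
  have hcoef : ∀ n, UnitAddTorus.mFourierCoeff Fc n = c n := by
    intro n
    rw [UnitAddTorus.mFourierCoeff_eq_integral _ n (0 : Fin k → ℝ), hc n]
    set e : (Fin k → ℝ) → ℂ := fun x =>
      Complex.exp (-(2 * Real.pi * Complex.I * ∑ i, (n i : ℂ) * (x i : ℂ))) with he
    have hec : Continuous e := by fun_prop
    have heper : ∀ x (b : Fin k → ℤ), e (x + ivec b) = e x := by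
      intro x b
      simp only [he]
      rw [Complex.exp_eq_exp_iff_exists_int]
      refine ⟨-∑ i, n i * b i, ?_⟩
      push_cast
      simp only [ivec, Pi.add_apply]
      push_cast
      simp only [mul_add, Finset.sum_add_distrib]
      ring
    have hcs : HasCompactSupport f := by
      refine HasCompactSupport.intro (isCompact_univ_pi (fun _ : Fin k => isCompact_Icc (a := -R) (b := R))) ?_
      intro x hx
      by_contra h
      exact hx (fun i _ => abs_le.mp (hR x h i))
    have hint : Integrable (fun x => e x * f x) :=
      (hec.mul hf).integrable_of_hasCompactSupport (hcs.mul_left)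
    rw [integral_unfold _ hint]
    set T := (finite_int_box (k := k) (R + 1)).toFinset with hT
    have hzero : ∀ x ∈ icube (0 : Fin k → ℤ), ∀ a ∉ T, f (x + ivec a) = 0 := by
      intro x hx a ha
      by_contra h
      refine ha ?_
      rw [hT, Set.Finite.mem_toFinset]
      refine hbound 1 x ?_ a h
      intro i
      have := hx i
      simp at this
      rw [abs_le]
      constructor <;> linarith
    rw [tsum_eq_sum (s := T)]
    · rw [← integral_finsetSum]
      · have hset : {x : Fin k → ℝ | ∀ i, x i ∈ Set.Ioc ((0 : Fin k → ℝ) i) ((0 : Fin k → ℝ) i + 1)}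
          = icube (0 : Fin k → ℤ) := by
          ext x; simp [icube]
        rw [hset]
        refine setIntegral_congr_fun (icube_meas _) ?_
        intro x hx
        show UnitAddTorus.mFourier (-n) (q x) • F (q x) = _
        rw [hchar, hFq, hFt]
        simp only [smul_eq_mul]
        rw [tsum_eq_sum (s := T) (fun a ha => hzero x hx a ha), Finset.mul_sum]
        refine Finset.sum_congr rfl fun a _ => ?_
        rw [heper]
      · intro a _
        exact (hint.comp_add_right (ivec a)).integrableOn
    · intro a ha
      rw [setIntegral_eq_zero_of_forall_eq_zero]
      intro x hx
      rw [hzero x hx a ha, mul_zero]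
  have hcoef' : (UnitAddTorus.mFourierCoeff Fc) = c := funext hcoef
  have hmain := UnitAddTorus.hasSum_mFourier_series_apply_of_summable (f := Fc)
    (by rw [hcoef']; exact hs) (q 0)
  have hval : Fc (q 0) = ∑' a : Fin k → ℤ, f (ivec a) := by
    show F (q 0) = _
    rw [hFq, hFt]
    simp
  rw [hval] at hmain
  convert! hmain using 1
  funext n
  rw [hcoef n]
  have := hchar (-n) 0
  rw [neg_neg] at this
  rw [this]
  simp

end Poisson

theorem fhat_eq_fourier (w : ℝ → ℝ) (ξ : ℝ) :
    fhat w ξ = FourierTransform.fourier (fun x => (w x : ℂ)) ξ := by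
  rw [Real.fourier_real_eq_integral_exp_smul, fhat]
  congr 1
  funext x
  rw [smul_eq_mul, mul_comm]
  congr 2
  push_cast
  ring

theorem fhat_decay (ℓ : ℕ) (w : ℝ → ℝ) (hs : Function.support w ⊆ Set.Icc (-2 : ℝ) 2)
    (hw : ContDiff ℝ ℓ w) :
    ∃ C : ℝ, 0 < C ∧ ∀ ξ : ℝ, ‖fhat w ξ‖ ≤ C / (max 1 |ξ|) ^ ℓ := by
  set f : ℝ → ℂ := fun x => (w x : ℂ) with hf
  have hfc : ContDiff ℝ ℓ f := Complex.ofRealCLM.contDiff.comp hw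
  have hcs : HasCompactSupport f := by
    refine HasCompactSupport.intro (isCompact_Icc (a := (-2 : ℝ)) (b := 2)) ?_
    intro x hx
    have : w x = 0 := by
      by_contra h
      exact hx (hs h)
    simp [hf, this]
  have hint : ∀ n : ℕ, (n : ℕ∞) ≤ (ℓ : ℕ∞) → MeasureTheory.Integrable (iteratedDeriv n f) := by
    intro n hn
    refine Continuous.integrable_of_hasCompactSupport ?_ ?_
    · exact hfc.continuous_iteratedDeriv n (by exact_mod_cast hn)
    · have : iteratedDeriv n f = fun x => iteratedFDeriv ℝ n f x (fun _ => 1) := by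
        funext x; rw [iteratedDeriv_eq_iteratedFDeriv]
      rw [this]
      exact (hcs.iteratedFDeriv n).comp_left (g := fun (m : ContinuousMultilinearMap ℝ (fun _ : Fin n => ℝ) ℂ) => m (fun _ => 1)) (by simp)
  set C0 := ∫ x, ‖f x‖
  set C1 := ∫ x, ‖iteratedDeriv ℓ f x‖
  have hC0 : 0 ≤ C0 := MeasureTheory.integral_nonneg (fun _ => norm_nonneg _)
  have hC1 : 0 ≤ C1 := MeasureTheory.integral_nonneg (fun _ => norm_nonneg _)
  have hb : ∀ (g : ℝ → ℂ) ξ, ‖FourierTransform.fourier g ξ‖ ≤ ∫ x, ‖g x‖ := by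
    intro g ξ
    rw [Real.fourier_real_eq_integral_exp_smul]
    refine (MeasureTheory.norm_integral_le_integral_norm _).trans (le_of_eq ?_)
    congr 1
    funext x
    rw [norm_smul, Complex.norm_exp_ofReal_mul_I, one_mul]
  refine ⟨C0 + C1 + 1, by positivity, fun ξ => ?_⟩
  rw [fhat_eq_fourier, le_div_iff₀ (by positivity)]
  by_cases hξ : |ξ| ≤ 1
  · rw [max_eq_left hξ, one_pow, mul_one]
    linarith [hb f ξ]
  · push Not at hξ
    rw [max_eq_right hξ.le]
    have h1 := Real.fourier_iteratedDeriv (f := f) (N := (ℓ : ℕ∞)) (n := ℓ) (by exact_mod_cast hfc) hint le_rfl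
    have h2 := hb (iteratedDeriv ℓ f) ξ
    rw [h1] at h2
    simp only [norm_smul, norm_pow, norm_mul, Complex.norm_I, mul_one, Complex.norm_real, Complex.norm_ofNat, Real.norm_eq_abs, abs_of_pos Real.pi_pos] at h2
    have h3 : |ξ| ^ ℓ ≤ (2 * Real.pi * |ξ|) ^ ℓ := by
      apply pow_le_pow_left₀ (abs_nonneg _)
      nlinarith [Real.pi_gt_three, abs_nonneg ξ]
    calc _ ≤ ‖FourierTransform.fourier f ξ‖ * (2 * Real.pi * |ξ|) ^ ℓ := by gcongr
      _ ≤ C1 := by rw [mul_comm]; exact h2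
      _ ≤ _ := by linarith

theorem fhat_scaled (w : ℝ → ℝ) (γ ρ m : ℝ) (hρ : 0 < ρ) :
    ∫ y : ℝ, Complex.exp (-(2 * Real.pi * Complex.I * (m * y))) * (w ((y - γ) / ρ) : ℂ) =
      ρ * Complex.exp (-(2 * Real.pi * Complex.I * (m * γ))) * fhat w (ρ * m) := by
  set g : ℝ → ℂ := fun u => Complex.exp (-(2 * Real.pi * Complex.I * (m * (ρ * u + γ)))) * (w u : ℂ) with hg
  have h1 : (fun y : ℝ => Complex.exp (-(2 * Real.pi * Complex.I * (m * y))) * (w ((y - γ) / ρ) : ℂ))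
      = fun y => (fun z => g (z / ρ)) (y - γ) := by
    funext y
    simp only [hg]
    congr 4
    push_cast
    have : (ρ : ℂ) ≠ 0 := by exact_mod_cast hρ.ne'
    field_simp
    ring
  rw [h1, MeasureTheory.integral_sub_right_eq_self (fun z => g (z / ρ)) γ, MeasureTheory.Measure.integral_comp_div,
    abs_of_pos hρ, fhat, mul_assoc, Complex.real_smul]
  congr 1
  rw [← MeasureTheory.integral_const_mul]
  congr 1
  funext u
  simp only [hg]
  have h2 : Complex.exp (-(2 * Real.pi * Complex.I * (m * (ρ * u + γ)))) =
      Complex.exp (-(2 * Real.pi * Complex.I * (m * γ))) *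
        Complex.exp (-(2 * Real.pi * Complex.I * ((ρ * m : ℝ) : ℂ) * u)) := by
    rw [← Complex.exp_add]
    congr 1
    push_cast
    ring
  rw [h2]
  ring

theorem coef_eq {k : ℕ} (A : Matrix (Fin k) (Fin k) ℝ) (hdet : |A.det| = 1)
    (w : Fin k → ℝ → ℝ) (hw : ∀ i, Continuous (w i)) (γ ρ : Fin k → ℝ) (hρ : ∀ i, 0 < ρ i)
    (n : Fin k → ℤ) :
    ∫ x : Fin k → ℝ, Complex.exp (-(2 * Real.pi * Complex.I * ∑ i, (n i : ℂ) * (x i : ℂ))) *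
      ((∏ i, w i ((A.mulVec x i - γ i) / ρ i) : ℝ) : ℂ) =
    ∏ i, (ρ i * Complex.exp (-(2 * Real.pi * Complex.I * (dualPt A n i * γ i))) *
      fhat (w i) (ρ i * dualPt A n i)) := by
  have hdet0 : A.det ≠ 0 := by
    intro h; rw [h] at hdet; simp at hdet
  have hunit : IsUnit A.det := isUnit_iff_ne_zero.mpr hdet0
  set g : (Fin k → ℝ) → ℂ := fun y => ∏ i,
    (Complex.exp (-(2 * Real.pi * Complex.I * (dualPt A n i * y i))) * (w i ((y i - γ i) / ρ i) : ℂ)) with hg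
  have hgc : Continuous g := by
    refine continuous_finsetProd _ fun i _ => ?_
    have := hw i
    fun_prop
  have hmap : MeasureTheory.Measure.map (Matrix.toLin' A) MeasureTheory.volume = (MeasureTheory.volume : MeasureTheory.Measure (Fin k → ℝ)) := by
    rw [Real.map_matrix_volume_pi_eq_smul_volume_pi hdet0, abs_inv, hdet]
    simp
  have h1 : ∀ x : Fin k → ℝ, Complex.exp (-(2 * Real.pi * Complex.I * ∑ i, (n i : ℂ) * (x i : ℂ))) *
      ((∏ i, w i ((A.mulVec x i - γ i) / ρ i) : ℝ) : ℂ) = g (Matrix.toLin' A x) := by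
    intro x
    simp only [hg, Matrix.toLin'_apply]
    rw [Finset.prod_mul_distrib, ← Complex.exp_sum, Finset.sum_neg_distrib, ← Finset.mul_sum]
    push_cast
    congr 4
    have h2 : ∑ i, (n i : ℝ) * x i = ∑ i, dualPt A n i * A.mulVec x i := by
      have : (dualPt A n) ⬝ᵥ (A.mulVec x) = (fun i => (n i : ℝ)) ⬝ᵥ x := by
        rw [dualPt, Matrix.mulVec_transpose, ← Matrix.dotProduct_mulVec, Matrix.mulVec_mulVec,
          Matrix.nonsing_inv_mul _ hunit, Matrix.one_mulVec]
      simpa [dotProduct] using this.symm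
    exact_mod_cast congrArg (fun r : ℝ => (r : ℂ)) h2
  simp_rw [h1]
  have h3 : ∫ x, g (Matrix.toLin' A x) = ∫ y, g y := by
    conv_rhs => rw [← hmap]
    rw [MeasureTheory.integral_map]
    · exact (LinearMap.continuous_of_finiteDimensional _).aemeasurable
    · exact hgc.aestronglyMeasurable
  rw [h3, hg, MeasureTheory.integral_fintype_prod_volume_eq_prod (f := fun i (y : ℝ) =>
    (Complex.exp (-(2 * Real.pi * Complex.I * (dualPt A n i * y))) * (w i ((y - γ i) / ρ i) : ℂ)))]
  refine Finset.prod_congr rfl fun i _ => ?_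
  rw [fhat_scaled _ _ _ _ (hρ i)]

theorem phi_growth (ℓ : ℕ) (φ : ℝ → ℝ) (ξ : ℝ)
    (hφmap : ∀ x, 1 ≤ x → 1 ≤ φ x)
    (hφmono : ∀ x y, 1 ≤ x → x ≤ y → φ x ≤ φ y)
    (hbdd : Filter.IsBoundedUnder (· ≤ ·) Filter.atTop (fun x : ℝ => φ (2 * x) / φ x))
    (hξ : ξ = Filter.limsup (fun x : ℝ => φ (2 * x) / φ x) Filter.atTop)
    (hℓ : (ℓ : ℝ) > 2 + 2 * Real.log ξ / Real.log 2) :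
    ∃ K η : ℝ, 0 < K ∧ 1 ≤ η ∧ 2 * η < 2 ^ ℓ ∧
      ∀ (n : ℕ) (x : ℝ), 1 ≤ x → φ (2 ^ n * x) ≤ K * η ^ n * φ x := by
  have hev : ∀ᶠ x : ℝ in Filter.atTop, 1 ≤ φ (2 * x) / φ x := by
    filter_upwards [Filter.eventually_ge_atTop (1 : ℝ)] with x hx
    rw [le_div_iff₀ (by linarith [hφmap x hx]), one_mul]
    exact hφmono _ _ hx (by linarith)
  have hξ1 : 1 ≤ ξ := by
    rw [hξ]
    exact Filter.le_limsup_of_frequently_le hev.frequently hbdd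
  have hlog2 : 0 < Real.log 2 := Real.log_pos (by norm_num)
  have hlogξ : 0 ≤ Real.log ξ := Real.log_nonneg hξ1
  have h4 : 2 * (2 * ξ) < 2 ^ ℓ := by
    have h1 : 2 * Real.log 2 + 2 * Real.log ξ < ℓ * Real.log 2 := by
      have : (2 + 2 * Real.log ξ / Real.log 2) * Real.log 2 < ℓ * Real.log 2 := by gcongr
      have h2 : (2 + 2 * Real.log ξ / Real.log 2) * Real.log 2 = 2 * Real.log 2 + 2 * Real.log ξ := by
        field_simp
      linarith
    have h2 : Real.log (2 * (2 * ξ)) < Real.log (2 ^ ℓ) := by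
      rw [Real.log_mul (by norm_num) (by positivity), Real.log_mul (by norm_num) (by positivity), Real.log_pow]
      linarith
    exact (Real.log_lt_log_iff (by positivity) (by positivity)).mp h2
  have hlt : ∀ᶠ x : ℝ in Filter.atTop, φ (2 * x) / φ x < 2 * ξ := by
    apply Filter.eventually_lt_of_limsup_lt _ hbdd
    rw [← hξ]; linarith
  obtain ⟨x1, hx1⟩ := Filter.eventually_atTop.mp hlt
  set x0 := max 1 x1 with hx0
  have hx01 : 1 ≤ x0 := le_max_left _ _
  set η := 2 * ξ with hη
  have hη1 : 1 ≤ η := by linarith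
  have hstep : ∀ x, x0 ≤ x → φ (2 * x) ≤ η * φ x := by
    intro x hx
    have := hx1 x ((le_max_right _ _).trans hx)
    rw [div_lt_iff₀ (by linarith [hφmap x (hx01.trans hx)])] at this
    exact this.le
  have hiter : ∀ (n : ℕ) x, x0 ≤ x → φ (2 ^ n * x) ≤ η ^ n * φ x := by
    intro n
    induction n with
    | zero => intro x _; simp
    | succ n ih =>
      intro x hx
      have h1 : x0 ≤ 2 ^ n * x := by
        have : (1 : ℝ) ≤ 2 ^ n := one_le_pow₀ (by norm_num)
        nlinarith
      have h2 := hstep _ h1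
      have h3 := ih x hx
      rw [pow_succ', pow_succ', mul_assoc, mul_assoc]
      exact h2.trans (by gcongr)
  refine ⟨φ x0, η, by linarith [hφmap x0 hx01], hη1, h4, ?_⟩
  intro n x hx
  have hp0 := hφmap x0 hx01
  have hpx := hφmap x hx
  have hpow : (1 : ℝ) ≤ 2 ^ n := one_le_pow₀ (by norm_num)
  have hηn : (1 : ℝ) ≤ η ^ n := one_le_pow₀ hη1
  by_cases h : x0 ≤ x
  · refine (hiter n x h).trans ?_
    have : 0 ≤ η ^ n * φ x := by positivity
    nlinarith
  · push Not at h
    have h1 : φ (2 ^ n * x) ≤ φ (2 ^ n * x0) :=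
      hφmono _ _ (by nlinarith) (by gcongr)
    refine h1.trans ((hiter n x0 le_rfl).trans ?_)
    have : 0 ≤ η ^ n * φ x0 := by positivity
    nlinarith

theorem dualPt_sub {k : ℕ} (A : Matrix (Fin k) (Fin k) ℝ) (a b : Fin k → ℤ) :
    dualPt A (a - b) = dualPt A a - dualPt A b := by
  rw [dualPt, dualPt, dualPt, ← Matrix.mulVec_sub]
  congr 1
  funext i
  simp

theorem dualPt_ne_zero {k : ℕ} (A : Matrix (Fin k) (Fin k) ℝ) (hdet : |A.det| = 1)
    (a : Fin k → ℤ) (ha : a ≠ 0) : dualPt A a ≠ 0 := by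
  have hdet0 : A.det ≠ 0 := by
    intro h; rw [h] at hdet; simp at hdet
  have hunit : IsUnit A.det := isUnit_iff_ne_zero.mpr hdet0
  intro h
  apply ha
  have h1 : A.transpose.mulVec (dualPt A a) = fun i => (a i : ℝ) := by
    rw [dualPt, Matrix.mulVec_mulVec, ← Matrix.transpose_mul, Matrix.nonsing_inv_mul _ hunit,
      Matrix.transpose_one, Matrix.one_mulVec]
  rw [h, Matrix.mulVec_zero] at h1
  funext i
  have := congrFun h1 i
  simp at this
  simpa using this.symm

theorem count_box (d : ℕ) (A : Matrix (Fin (d+1)) (Fin (d+1)) ℝ) (hdet : |A.det| = 1)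
    (φ : ℝ → ℝ)
    (hφmap : ∀ x, 1 ≤ x → 1 ≤ φ x)
    (hφmono : ∀ x y, 1 ≤ x → x ≤ y → φ x ≤ φ y)
    (hbad : DualBad d A φ) (P : Fin (d+1) → ℝ) (hP : ∀ i, 0 < P i)
    (hP1 : ∀ i : Fin d, P i.castSucc ≤ 1) (j : Fin (d+1) → ℕ) (X : ℝ)
    (hX : X = ∏ i : Fin d, (2 ^ (j i.castSucc + 1) / P i.castSucc))
    (S : Finset (Fin (d+1) → ℤ))
    (hS : ∀ n ∈ S, n ≠ 0 ∧ ∀ i, |P i * dualPt A n i| ≤ 2 ^ (j i)) :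
    (S.card : ℝ) ≤ 4 * 2 ^ (j (Fin.last d)) * (X * φ X) / P (Fin.last d) := by
  have hfac : ∀ i : Fin d, (1 : ℝ) ≤ 2 ^ (j i.castSucc + 1) / P i.castSucc := by
    intro i
    rw [le_div_iff₀ (hP _), one_mul]
    exact (hP1 i).trans (one_le_pow₀ (by norm_num))
  have hX1 : 1 ≤ X := by
    rw [hX]
    exact Finset.prod_induction _ (fun x : ℝ => 1 ≤ x) (fun a b ha hb => by nlinarith) le_rfl
      (fun i _ => hfac i)
  have hφX := hφmap X hX1
  set δ := 1 / (X * φ X) with hδ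
  have hδ0 : 0 < δ := by positivity
  -- separation
  have hsep : ∀ n : Fin (d+1) → ℤ, n ≠ 0 →
      (∀ i : Fin d, |dualPt A n i.castSucc| ≤ 2 ^ (j i.castSucc + 1) / P i.castSucc) →
      δ < |dualPt A n (Fin.last d)| := by
    intro n hn hb
    have h1 := hbad n (dualPt_ne_zero A hdet n hn)
    set H := Hmul (fun i : Fin d => dualPt A n i.castSucc) with hH
    have hH1 : 1 ≤ H := by
      rw [hH, Hmul]
      exact Finset.prod_induction _ (fun x : ℝ => 1 ≤ x) (fun a b ha hb => by nlinarith) le_rfl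
        (fun i _ => le_max_left _ _)
    have hHX : H ≤ X := by
      rw [hH, Hmul, hX]
      exact Finset.prod_le_prod (fun i _ => by positivity) (fun i _ => max_le (hfac i) (hb i))
    have hφH := hφmap H hH1
    have hφHX := hφmono H X hH1 hHX
    have h2 : δ ≤ 1 / (H * φ H) := by
      rw [hδ]
      gcongr
    have h3 : 1 / (H * φ H) < |dualPt A n (Fin.last d)| := by
      rw [div_lt_iff₀ (by positivity)]
      rw [gt_iff_lt, div_lt_iff₀ (by positivity)] at h1
      linarith
    linarith
  have hmi : ∀ n ∈ S, ∀ i, |dualPt A n i| ≤ 2 ^ (j i) / P i := by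
    intro n hn i
    have := (hS n hn).2 i
    rw [abs_mul, abs_of_pos (hP i)] at this
    rw [le_div_iff₀ (hP i)]; linarith
  rcases S.eq_empty_or_nonempty with hE | ⟨n0, hn0⟩
  · rw [hE]
    have := hP (Fin.last d)
    simp only [Finset.card_empty, Nat.cast_zero]
    positivity
  set Y := 2 ^ (j (Fin.last d)) / P (Fin.last d) / δ with hY
  have hY1 : 1 < Y := by
    have h1 := hsep n0 (hS n0 hn0).1 (fun i => (hmi n0 hn0 i.castSucc).trans (by
      have := hP i.castSucc
      gcongr
      · norm_num
      · omega))
    have h2 := hmi n0 hn0 (Fin.last d)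
    rw [hY, lt_div_iff₀ hδ0]; linarith
  have hinj : Set.InjOn (fun n : Fin (d+1) → ℤ => ⌊dualPt A n (Fin.last d) / δ⌋) S := by
    intro a ha b hb hab
    by_contra hne
    have h1 := Int.abs_sub_lt_one_of_floor_eq_floor hab
    have h2 : |dualPt A (a - b) (Fin.last d)| < δ := by
      rw [dualPt_sub, Pi.sub_apply]
      rw [← sub_div, abs_div, abs_of_pos hδ0, div_lt_one hδ0] at h1
      exact h1
    have h3 := hsep (a - b) (sub_ne_zero.mpr hne) (fun i => by
      rw [dualPt_sub, Pi.sub_apply]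
      have e1 := hmi a ha i.castSucc
      have e2 := hmi b hb i.castSucc
      have e3 := abs_sub (dualPt A a i.castSucc) (dualPt A b i.castSucc)
      rw [pow_succ, mul_div_right_comm]
      linarith)
    linarith
  have hmaps : ∀ n ∈ S, ⌊dualPt A n (Fin.last d) / δ⌋ ∈ Finset.Icc ⌊-Y⌋ ⌊Y⌋ := by
    intro n hn
    have h2 := abs_le.mp (hmi n hn (Fin.last d))
    rw [Finset.mem_Icc]
    constructor
    · apply Int.floor_le_floor
      rw [hY, ← neg_div]
      gcongr
      exact h2.1
    · apply Int.floor_le_floor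
      rw [hY]
      gcongr
      exact h2.2
  have hcard := Finset.card_le_card_of_injOn _ hmaps hinj
  rw [Int.card_Icc] at hcard
  have hc2 : (S.card : ℝ) ≤ ((⌊Y⌋ + 1 - ⌊-Y⌋).toNat : ℝ) := by exact_mod_cast hcard
  have hmono : ⌊-Y⌋ ≤ ⌊Y⌋ := Int.floor_le_floor (by linarith)
  have hc3 : ((⌊Y⌋ + 1 - ⌊-Y⌋).toNat : ℝ) = (⌊Y⌋ : ℝ) + 1 - ⌊-Y⌋ := by
    have : ((⌊Y⌋ + 1 - ⌊-Y⌋).toNat : ℤ) = ⌊Y⌋ + 1 - ⌊-Y⌋ := Int.toNat_of_nonneg (by omega)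
    exact_mod_cast congrArg (fun z : ℤ => (z : ℝ)) this
  have hf1 := Int.floor_le Y
  have hf2 := Int.lt_floor_add_one (-Y)
  have hfin : (S.card : ℝ) ≤ 4 * Y := by linarith
  refine hfin.trans (le_of_eq ?_)
  have := hP (Fin.last d)
  rw [hY, hδ]
  field_simp

theorem exists_level (x : ℝ) : ∃ j : ℕ, |x| ≤ 2 ^ j ∧ (2 : ℝ) ^ j ≤ 2 * max 1 |x| := by
  obtain ⟨n, h1, h2⟩ := exists_nat_pow_near (le_max_left 1 |x|) (one_lt_two)
  refine ⟨n + 1, (le_max_right _ _).trans h2.le, ?_⟩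
  rw [pow_succ]; linarith

theorem sum_bound (d ℓ : ℕ) (A : Matrix (Fin (d+1)) (Fin (d+1)) ℝ) (hdet : |A.det| = 1)
    (φ : ℝ → ℝ)
    (hφmap : ∀ x, 1 ≤ x → 1 ≤ φ x)
    (hφmono : ∀ x y, 1 ≤ x → x ≤ y → φ x ≤ φ y)
    (hbad : DualBad d A φ) (K η : ℝ) (hK : 0 < K) (hη : 1 ≤ η) (hηℓ : 2 * η < 2 ^ ℓ)
    (hgrow : ∀ (n : ℕ) (x : ℝ), 1 ≤ x → φ (2 ^ n * x) ≤ K * η ^ n * φ x) :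
    ∃ C : ℝ, 0 < C ∧ ∀ (P : Fin (d+1) → ℝ), (∀ i, 0 < P i) → (∀ i : Fin d, P i.castSucc ≤ 1) →
      ∀ L : ℝ, 1 ≤ L → 1 / (∏ i : Fin d, P i.castSucc) ≤ L →
      ∀ S : Finset (Fin (d+1) → ℤ), (∀ n ∈ S, n ≠ 0) →
      ∑ n ∈ S, ∏ i, 1 / (max 1 |P i * dualPt A n i|) ^ ℓ ≤ C * φ L / ∏ i, P i := by
  classical
  set r : ℝ := 2 * η / 2 ^ ℓ with hr
  have hr0 : 0 < r := by positivity
  have hr1 : r < 1 := by rw [hr, div_lt_one (by positivity)]; exact hηℓ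
  set B : ℝ := 4 * K * (2 * η) ^ d * (2 ^ ℓ) ^ (d+1) with hB
  have hB0 : 0 < B := by positivity
  have h1r : 0 < 1 - r := by linarith
  refine ⟨B * ((1 - r)⁻¹) ^ (d+1), by positivity, ?_⟩
  intro P hP hP1 L hL hPL S hS
  have hφL := hφmap L hL
  have hPprod : 0 < ∏ i, P i := Finset.prod_pos (fun i _ => hP i)
  have hPd : 0 < ∏ i : Fin d, P i.castSucc := Finset.prod_pos (fun i _ => hP _)
  choose lev hlev1 hlev2 using exists_level
  set J : (Fin (d+1) → ℤ) → (Fin (d+1) → ℕ) := fun n i => lev (P i * dualPt A n i) with hJ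
  obtain ⟨M, hM⟩ : ∃ M : ℕ, ∀ n ∈ S, ∀ i, J n i < M := by
    refine ⟨(S.sup fun n => Finset.univ.sup (J n)) + 1, fun n hn i => ?_⟩
    have h1 : J n i ≤ Finset.univ.sup (J n) := Finset.le_sup (f := J n) (Finset.mem_univ i)
    have h2 : Finset.univ.sup (J n) ≤ S.sup fun n => Finset.univ.sup (J n) :=
      Finset.le_sup (f := fun n => Finset.univ.sup (J n)) hn
    omega
  set T : Finset (Fin (d+1) → ℕ) := Fintype.piFinset (fun _ => Finset.range M) with hT
  have hmaps : ∀ n ∈ S, J n ∈ T := by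
    intro n hn
    rw [hT, Fintype.mem_piFinset]
    intro i
    exact Finset.mem_range.mpr (hM n hn i)
  rw [← Finset.sum_fiberwise_of_maps_to hmaps]
  have hterm : ∀ n, ∏ i, 1 / (max 1 |P i * dualPt A n i|) ^ ℓ ≤ ∏ i, ((2 : ℝ) ^ ℓ / (2 ^ ℓ) ^ (J n i)) := by
    intro n
    refine Finset.prod_le_prod (fun i _ => by positivity) (fun i _ => ?_)
    have h1 := hlev2 (P i * dualPt A n i)
    have h2 : ((2 : ℝ) ^ ℓ) ^ (J n i) ≤ 2 ^ ℓ * (max 1 |P i * dualPt A n i|) ^ ℓ := by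
      rw [← pow_mul, mul_comm ℓ, pow_mul, ← mul_pow]
      gcongr
    rw [div_le_div_iff₀ (by positivity) (by positivity)]
    linarith
  have hfib : ∀ j ∈ T, ∑ n ∈ S with J n = j, ∏ i, 1 / (max 1 |P i * dualPt A n i|) ^ ℓ
      ≤ (B * φ L / ∏ i, P i) * ∏ i, r ^ (j i) := by
    intro j _
    set X : ℝ := ∏ i : Fin d, (2 ^ (j i.castSucc + 1) / P i.castSucc) with hX
    have hcount := count_box d A hdet φ hφmap hφmono hbad P hP hP1 j X hX
      (S.filter fun n => J n = j) (by
        intro n hn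
        rw [Finset.mem_filter] at hn
        refine ⟨hS n hn.1, fun i => ?_⟩
        rw [← hn.2]
        exact hlev1 _)
    have hXe : X = 2 ^ (∑ i : Fin d, (j i.castSucc + 1)) / ∏ i : Fin d, P i.castSucc := by
      rw [hX, Finset.prod_div_distrib, Finset.prod_pow_eq_pow_sum]
    set s : ℕ := ∑ i : Fin d, (j i.castSucc + 1) with hs
    have hX1 : 1 ≤ X := by
      rw [hX]
      refine Finset.prod_induction _ (fun x : ℝ => 1 ≤ x) (fun a b ha hb => by nlinarith) le_rfl
        (fun i _ => ?_)
      rw [le_div_iff₀ (hP _), one_mul]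
      exact (hP1 i).trans (one_le_pow₀ (by norm_num))
    have hφX : φ X ≤ K * η ^ s * φ L := by
      refine (hφmono X (2 ^ s * L) hX1 ?_).trans (hgrow s L hL)
      rw [hXe, div_eq_mul_one_div]
      gcongr
    have hsum : s = (∑ i : Fin d, j i.castSucc) + d := by
      rw [hs, Finset.sum_add_distrib]; simp
    have hPl := hP (Fin.last d)
    calc ∑ n ∈ S with J n = j, ∏ i, 1 / (max 1 |P i * dualPt A n i|) ^ ℓ
        ≤ ∑ n ∈ S with J n = j, ∏ i, ((2 : ℝ) ^ ℓ / (2 ^ ℓ) ^ (j i)) := by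
          refine Finset.sum_le_sum fun n hn => ?_
          have := hterm n
          rw [(Finset.mem_filter.mp hn).2] at this
          exact this
      _ = ((S.filter fun n => J n = j).card : ℝ) * ∏ i, ((2 : ℝ) ^ ℓ / (2 ^ ℓ) ^ (j i)) := by
          rw [Finset.sum_const, nsmul_eq_mul]
      _ ≤ (4 * 2 ^ (j (Fin.last d)) * (X * (K * η ^ s * φ L)) / P (Fin.last d)) *
            ∏ i, ((2 : ℝ) ^ ℓ / (2 ^ ℓ) ^ (j i)) := by
          gcongr
          refine hcount.trans ?_
          gcongr
      _ ≤ (B * φ L / ∏ i, P i) * ∏ i, r ^ (j i) := by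
          have e1 : ∏ i, ((2 : ℝ) ^ ℓ / (2 ^ ℓ) ^ (j i)) = (2 ^ ℓ) ^ (d+1) / ∏ i, ((2 : ℝ) ^ ℓ) ^ (j i) := by
            rw [Finset.prod_div_distrib]; simp
          have e2 : ∏ i, r ^ (j i) = (∏ i, (2 * η) ^ (j i)) / ∏ i, ((2 : ℝ) ^ ℓ) ^ (j i) := by
            rw [← Finset.prod_div_distrib]
            refine Finset.prod_congr rfl fun i _ => ?_
            rw [hr, div_pow]
          have e3 : ∏ i, (2 * η) ^ (j i) = (2 * η) ^ (∑ i : Fin d, j i.castSucc) * (2 * η) ^ (j (Fin.last d)) := by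
            rw [Fin.prod_univ_castSucc, Finset.prod_pow_eq_pow_sum]
          have e4 : ∏ i, P i = (∏ i : Fin d, P i.castSucc) * P (Fin.last d) := Fin.prod_univ_castSucc _
          have hQ : 0 < ∏ i, ((2 : ℝ) ^ ℓ) ^ (j i) := Finset.prod_pos fun i _ => by positivity
          have e5 : (2 : ℝ) ^ (j (Fin.last d)) ≤ (2 * η) ^ (j (Fin.last d)) := by
            gcongr; linarith
          rw [e1, e2, e3, e4, hXe, hsum, hB]
          set u := ∑ i : Fin d, j i.castSucc
          set Q := ∏ i, ((2 : ℝ) ^ ℓ) ^ (j i)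
          set p := ∏ i : Fin d, P i.castSucc
          set q := P (Fin.last d)
          calc _ = (4 * (2 ^ (u + d) / p * (K * η ^ (u + d) * φ L)) / q * ((2 ^ ℓ) ^ (d + 1) / Q)) * 2 ^ (j (Fin.last d)) := by ring
            _ ≤ (4 * (2 ^ (u + d) / p * (K * η ^ (u + d) * φ L)) / q * ((2 ^ ℓ) ^ (d + 1) / Q)) * (2 * η) ^ (j (Fin.last d)) := by gcongr
            _ = _ := by
              have : (2 : ℝ) ^ (u + d) * η ^ (u + d) = (2 * η) ^ d * (2 * η) ^ u := by
                rw [← mul_pow, ← pow_add, add_comm]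
              field_simp
              linear_combination (4 * K * φ L * (2 ^ ℓ) ^ (d + 1) * (2 * η) ^ (j (Fin.last d))) * this
  calc _ ≤ ∑ j ∈ T, (B * φ L / ∏ i, P i) * ∏ i, r ^ (j i) := Finset.sum_le_sum hfib
    _ = (B * φ L / ∏ i, P i) * ∏ i : Fin (d+1), ∑ m ∈ Finset.range M, r ^ m := by
      rw [← Finset.mul_sum, hT, Finset.prod_univ_sum]
    _ ≤ (B * φ L / ∏ i, P i) * ((1 - r)⁻¹) ^ (d+1) := by
      gcongr
      rw [Finset.prod_const, Finset.card_univ, Fintype.card_fin]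
      gcongr
      rw [← tsum_geometric_of_lt_one hr0.le hr1]
      exact (summable_geometric_of_lt_one hr0.le hr1).sum_le_tsum _ (fun _ _ => by positivity)
    _ = _ := by ring

/-- Proposition: discrepancy bound for boxes of large volume. -/
theorem smooth_lattice_discrepancy_large_boxes
    (d : ℕ) (hd : 1 ≤ d) (A : Matrix (Fin (d+1)) (Fin (d+1)) ℝ) (hdet : |A.det| = 1)
    (ℓ : ℕ) (w : Fin (d+1) → ℝ → ℝ) (hw : GoodWeights (d+1) ℓ w)
    (φ L : ℝ → ℝ) (ξ : ℝ)
    (hφmap : ∀ x, 1 ≤ x → 1 ≤ φ x)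
    (hφmono : ∀ x y, 1 ≤ x → x ≤ y → φ x ≤ φ y)
    (hbad : DualBad d A φ)
    (hbdd : Filter.IsBoundedUnder (· ≤ ·) Filter.atTop (fun x : ℝ => φ (2 * x) / φ x))
    (hξ : ξ = Filter.limsup (fun x : ℝ => φ (2 * x) / φ x) Filter.atTop)
    (hℓ : (ℓ : ℝ) > 2 + 2 * Real.log ξ / Real.log 2)
    (hLmap : ∀ x, φ 1 ≤ x → 1 ≤ L x)
    (hLdef : ∀ x, φ 1 ≤ x → L x * φ (L x) = x) :
    ∃ C : ℝ, 0 < C ∧ ∀ N : ℕ, φ 1 ≤ (N : ℝ) → ∀ γ ρ : Fin d → ℝ, IsBox ρ →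
      φ (L N) < (∏ i, ρ i) * N →
      |DboxLat d A w γ ρ N| ≤ C * φ (L N) := by
  classical
  have hwpos := fun i => (hw i).1
  have hwsup := fun i => (hw i).2.1
  have hwcd := fun i => (hw i).2.2.1
  have hwim := fun i => (hw i).2.2.2.1
  have hwc : ∀ i, Continuous (w i) := fun i => (hwcd i).continuous
  obtain ⟨K, η, hK, hη, hηℓ, hgrow⟩ := phi_growth ℓ φ ξ hφmap hφmono hbdd hξ hℓ
  obtain ⟨C1, hC1, hsum⟩ := sum_bound d ℓ A hdet φ hφmap hφmono hbad K η hK hη hηℓ hgrow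
  choose Cw hCw0 hCw using fun i => fhat_decay ℓ (w i) (hwsup i) (hwcd i)
  have hCwp : 0 < ∏ i, Cw i := Finset.prod_pos fun i _ => hCw0 i
  refine ⟨(∏ i, Cw i) * C1, by positivity, ?_⟩
  intro N hN γ ρ hρ hvol
  have hφ1 := hφmap 1 le_rfl
  have hN0 : (0 : ℝ) < N := by linarith
  set P : Fin (d+1) → ℝ := Fin.snoc (α := fun _ => ℝ) ρ (N : ℝ) with hPdef
  set Γ : Fin (d+1) → ℝ := Fin.snoc (α := fun _ => ℝ) γ (0 : ℝ) with hΓdef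
  have hPc : ∀ i : Fin d, P i.castSucc = ρ i := fun i => by simp [hPdef]
  have hPl : P (Fin.last d) = N := by simp [hPdef]
  have hΓc : ∀ i : Fin d, Γ i.castSucc = γ i := fun i => by simp [hΓdef]
  have hΓl : Γ (Fin.last d) = 0 := by simp [hΓdef]
  have hP : ∀ i, 0 < P i := by
    intro i
    refine Fin.lastCases ?_ (fun i => ?_) i
    · rw [hPl]; exact hN0
    · rw [hPc]; exact (hρ i).1
  have hP1 : ∀ i : Fin d, P i.castSucc ≤ 1 := by
    intro i; rw [hPc]; linarith [(hρ i).2]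
  have hPprod : ∏ i, P i = (∏ i, ρ i) * N := by
    rw [Fin.prod_univ_castSucc, hPl]; simp only [hPc]
  have hPpos : 0 < ∏ i, P i := Finset.prod_pos fun i _ => hP i
  have hρpos : 0 < ∏ i, ρ i := Finset.prod_pos fun i _ => (hρ i).1
  set Lv := L (N : ℝ) with hLv
  have hLv1 : 1 ≤ Lv := hLmap _ hN
  have hLvN : Lv * φ Lv = N := hLdef _ hN
  have hφL := hφmap Lv hLv1
  have hPL : 1 / (∏ i : Fin d, P i.castSucc) ≤ Lv := by
    simp only [hPc]
    rw [div_le_iff₀ hρpos]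
    rw [← hLvN] at hvol
    by_contra hcon
    push Not at hcon
    nlinarith
  have hsumP := hsum P hP hP1 Lv hLv1 hPL
  set b : (Fin (d+1) → ℤ) → ℝ := fun n => ∏ i, 1 / (max 1 |P i * dualPt A n i|) ^ ℓ with hb
  have hb0 : ∀ n, 0 ≤ b n := fun n => Finset.prod_nonneg fun i _ => by positivity
  have hbsum : Summable b := by
    refine summable_of_sum_le (c := C1 * φ Lv / ∏ i, P i + b 0) hb0 ?_
    intro S
    have h1 := hsumP (S.erase 0) (fun n hn => (Finset.mem_erase.mp hn).1)
    have h2 : ∑ n ∈ S, b n ≤ ∑ n ∈ insert 0 (S.erase 0), b n := by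
      refine Finset.sum_le_sum_of_subset_of_nonneg ?_ (fun n _ _ => hb0 n)
      intro n hn
      by_cases h : n = 0
      · simp [h]
      · simp [h, hn]
    rw [Finset.sum_insert (by simp)] at h2
    linarith
  set c : (Fin (d+1) → ℤ) → ℂ := fun n => ∏ i,
    (P i * Complex.exp (-(2 * Real.pi * Complex.I * (dualPt A n i * Γ i))) *
      fhat (w i) (P i * dualPt A n i)) with hc
  have hcb : ∀ n, ‖c n‖ ≤ (∏ i, P i) * (∏ i, Cw i) * b n := by
    intro n
    rw [hc, hb, norm_prod, ← Finset.prod_mul_distrib, ← Finset.prod_mul_distrib]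
    refine Finset.prod_le_prod (fun i _ => norm_nonneg _) (fun i _ => ?_)
    have e1 : ‖Complex.exp (-(2 * Real.pi * Complex.I * (dualPt A n i * Γ i)))‖ = 1 := by
      have : (-(2 * Real.pi * Complex.I * (dualPt A n i * Γ i)) : ℂ) =
          ((-(2 * Real.pi * (dualPt A n i * Γ i)) : ℝ) : ℂ) * Complex.I := by
        push_cast; ring
      rw [this, Complex.norm_exp_ofReal_mul_I]
    rw [norm_mul, norm_mul, e1, mul_one, Complex.norm_real, Real.norm_eq_abs, abs_of_pos (hP i),
      mul_assoc]
    have := hCw i (P i * dualPt A n i)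
    rw [mul_one_div]
    exact mul_le_mul_of_nonneg_left this (hP i).le
  have hcsum : Summable c := Summable.of_norm_bounded (hbsum.mul_left _) hcb
  set f : (Fin (d+1) → ℝ) → ℂ := fun x =>
    ((∏ i, w i ((A.mulVec x i - Γ i) / P i) : ℝ) : ℂ) with hf
  have hfc : Continuous f := by
    refine Complex.continuous_ofReal.comp (continuous_finsetProd _ fun i _ => (hwc i).comp ?_)
    have : Continuous fun x : Fin (d+1) → ℝ => A.mulVec x i :=
      (continuous_apply i).comp (Continuous.matrix_mulVec continuous_const continuous_id)
    exact (this.sub continuous_const).div_const _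
  have hdet0 : A.det ≠ 0 := by
    intro h; rw [h] at hdet; simp at hdet
  have hunit : IsUnit A.det := isUnit_iff_ne_zero.mpr hdet0
  have hR : ∀ x, f x ≠ 0 → ∀ i, |x i| ≤ ∑ i, ∑ j, |A⁻¹ i j| * (2 * P j + |Γ j|) := by
    intro x hx i
    have h1 : ∀ j, |A.mulVec x j| ≤ 2 * P j + |Γ j| := by
      intro j
      have h2 : w j ((A.mulVec x j - Γ j) / P j) ≠ 0 := by
        intro h
        apply hx
        rw [hf]
        simp only
        rw [Finset.prod_eq_zero (Finset.mem_univ j) h, Complex.ofReal_zero]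
      have h3 := hwsup j h2
      have h4 : |(A.mulVec x j - Γ j) / P j| ≤ 2 := abs_le.mpr h3
      rw [abs_div, abs_of_pos (hP j), div_le_iff₀ (hP j)] at h4
      have h5 := abs_sub_abs_le_abs_sub (A.mulVec x j) (Γ j)
      linarith
    have h6 : x i = ∑ j, A⁻¹ i j * A.mulVec x j := by
      have : A⁻¹.mulVec (A.mulVec x) = x := by
        rw [Matrix.mulVec_mulVec, Matrix.nonsing_inv_mul _ hunit, Matrix.one_mulVec]
      conv_lhs => rw [← this]
      rfl
    have hnn : ∀ i j, 0 ≤ |A⁻¹ i j| * (2 * P j + |Γ j|) := fun i j => by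
      have := hP j; positivity
    calc |x i| ≤ ∑ j, |A⁻¹ i j * A.mulVec x j| := by rw [h6]; exact Finset.abs_sum_le_sum_abs _ _
      _ ≤ ∑ j, |A⁻¹ i j| * (2 * P j + |Γ j|) := by
        refine Finset.sum_le_sum fun j _ => ?_
        rw [abs_mul]
        exact mul_le_mul_of_nonneg_left (h1 j) (abs_nonneg _)
      _ ≤ _ := Finset.single_le_sum (f := fun i => ∑ j, |A⁻¹ i j| * (2 * P j + |Γ j|))
        (fun i _ => Finset.sum_nonneg fun j _ => hnn i j) (Finset.mem_univ i)
  have hpois := poisson_multi f hfc _ hR c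
    (fun n => (coef_eq A hdet w hwc Γ P hP n).symm) hcsum
  have hc0 : c 0 = ((smoothC w * ((∏ i, ρ i) * N) : ℝ) : ℂ) := by
    have hd0 : dualPt A (0 : Fin (d+1) → ℤ) = 0 := by
      rw [dualPt]
      have : (fun i => (((0 : Fin (d+1) → ℤ) i : ℤ) : ℝ)) = 0 := by funext i; simp
      rw [this, Matrix.mulVec_zero]
    rw [hc, ← hPprod, smoothC, ← Finset.prod_mul_distrib, Complex.ofReal_prod]
    refine Finset.prod_congr rfl fun i _ => ?_
    have him : ((fhat (w i) 0).re : ℂ) = fhat (w i) 0 := by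
      apply Complex.ext
      · simp
      · simp [(hwim i 0).1]
    simp only [hd0, Pi.zero_apply, Complex.ofReal_zero, zero_mul, mul_zero, neg_zero, Complex.exp_zero, mul_one,
      Complex.ofReal_mul]
    rw [him, mul_comm]
  have hF : (∑' a : Fin (d+1) → ℤ, f (ivec a)) - c 0 = ((DboxLat d A w γ ρ N : ℝ) : ℂ) := by
    rw [hc0, DboxLat, Complex.ofReal_sub, Complex.ofReal_tsum]
    congr 1
    refine tsum_congr fun a => ?_
    rw [hf]
    simp only
    rw [Fin.prod_univ_castSucc, hPl, hΓl, sub_zero, mul_comm]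
    simp only [hPc, hΓc]
    rfl
  have hs2 := hasSum_ite_sub_hasSum hpois 0
  rw [hF] at hs2
  have hnorm : ‖((DboxLat d A w γ ρ N : ℝ) : ℂ)‖ ≤ (∏ i, Cw i) * C1 * φ Lv := by
    refine le_of_tendsto (Filter.Tendsto.norm hs2) (Filter.Eventually.of_forall fun S => ?_)
    have h1 : ∑ n ∈ S, (if n = 0 then 0 else c n) = ∑ n ∈ S.erase 0, c n := by
      rw [← Finset.filter_ne', Finset.sum_filter]
      refine Finset.sum_congr rfl fun n _ => ?_
      by_cases h : n = 0 <;> simp [h]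
    calc ‖∑ n ∈ S, (if n = 0 then 0 else c n)‖ = ‖∑ n ∈ S.erase 0, c n‖ := by rw [h1]
      _ ≤ ∑ n ∈ S.erase 0, (∏ i, P i) * (∏ i, Cw i) * b n :=
        norm_sum_le_of_le _ fun n _ => hcb n
      _ = (∏ i, P i) * (∏ i, Cw i) * ∑ n ∈ S.erase 0, b n := by rw [Finset.mul_sum]
      _ ≤ (∏ i, P i) * (∏ i, Cw i) * (C1 * φ Lv / ∏ i, P i) := by
        refine mul_le_mul_of_nonneg_left ?_ (by positivity)
        exact hsumP (S.erase 0) (fun n hn => (Finset.mem_erase.mp hn).1)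
      _ = _ := by field_simp
  rw [Complex.norm_real, Real.norm_eq_abs] at hnorm
  exact hnorm
end
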